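/- Let Λ be an artin algebra. Assume u : X → M is an irreducible monomorphism with M indecomposable and g₀ : M → Y is an epimorphism such that the composition g₀∘u : X → Y is a Gabriel-Roiter inclusion. Then either (a) there exist n ≥ 0, indecomposable modules M = M_0, M_1, …, M_n = Y and irreducible maps f_i : M_{i-1} → M_i (1 ≤ i ≤ n) such that u is a monomorphism, the composition f_n∘⋯∘f_1 is an epimorphism, and f_n∘⋯∘f_1∘u : X → Y is a Gabriel-Roiter inclusion; or (b) for every natural number m there exist indecomposable modules M = M_0, M_1, …, M_m, irreducible maps f_i : M_{i-1} → M_i (1 ≤ i ≤ m) and a map g : M_m → Y such that g∘f_m∘⋯∘f_1 is an epimorphism and g∘f_m∘⋯∘f_1∘u : X → Y is a Gabriel-Roiter inclusion. -/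

import Mathlib

/-!
Setting: `k` is a commutative artinian ring and `Λ` an artin `k`-algebra
(an algebra over `k` which is finitely generated as a `k`-module).
All modules considered are `Λ`-modules of finite length (`IsFiniteLength Λ M`),
and `|M|` denotes the length of `M`, implemented as the height
`Order.height (⊤ : Submodule Λ M)` of the lattice of submodules
(for a submodule `N` of an ambient module, its length is `Order.height N`).
-/

universe u v

open Submodule

section GRDefs

variable (Λ : Type u) [Ring Λ]

/-- A submodule `N` of an ambient module is indecomposable (as a module):
it is nonzero, and whenever it is the direct sum of two submodules, one of them is zero. -/
def IndecSub {Y : Type v} [AddCommGroup Y] [Module Λ Y] (N : Submodule Λ Y) : Prop :=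
  N ≠ ⊥ ∧ ∀ A B : Submodule Λ Y, A ≤ N → B ≤ N → A ⊔ B = N → A ⊓ B = ⊥ → A = ⊥ ∨ B = ⊥

/-- A module is indecomposable iff its top submodule is. -/
def IndecMod (M : Type v) [AddCommGroup M] [Module Λ M] : Prop :=
  IndecSub Λ (⊤ : Submodule Λ M)

/-- The length `|M|` of a module, as an extended natural number. -/
noncomputable def modLen (M : Type v) [AddCommGroup M] [Module Λ M] : ℕ∞ :=
  Order.height (⊤ : Submodule Λ M)

/-- The length `|N|` of a submodule of an ambient module, as a natural number. -/
noncomputable def subLen {Y : Type v} [AddCommGroup Y] [Module Λ Y] (N : Submodule Λ Y) : ℕ :=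
  (Order.height N).toNat

open Classical in
/-- Fuel-based auxiliary function for the Gabriel-Roiter measure. -/
noncomputable def muAux {Y : Type v} [AddCommGroup Y] [Module Λ Y] :
    ℕ → Submodule Λ Y → ℝ
  | 0, _ => 0
  | n + 1, N =>
      (if IndecSub Λ N then (2 : ℝ) ^ (-(subLen Λ N : ℤ)) else 0)
        + sSup (muAux n '' {N' : Submodule Λ Y | N' < N})

/-- The Gabriel-Roiter measure `μ(N)` of a submodule `N` of an ambient module:
`μ(0) = 0`; if `N ≠ 0` is decomposable, `μ(N)` is the maximum of `μ(N')` over proper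
submodules `N'` of `N`; if `N` is indecomposable, `μ(N) = 2^(-|N|)` plus this maximum.
(For modules of finite length the supremum is a maximum and the fuel `|N|` suffices for
the recursion, so this agrees with the usual inductive definition; the measure of a
submodule depends only on the sublattice of its submodules, hence it does not matter
in which ambient module it is computed.) -/
noncomputable def mu {Y : Type v} [AddCommGroup Y] [Module Λ Y] (N : Submodule Λ Y) : ℝ :=
  muAux Λ (subLen Λ N) N

/-- The Gabriel-Roiter measure of a module. -/
noncomputable def muMod (M : Type v) [AddCommGroup M] [Module Λ M] : ℝ :=
  mu Λ (⊤ : Submodule Λ M)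

/-- `X` is a Gabriel-Roiter submodule of the (indecomposable, non-simple) ambient
module `Y`: `X` is an indecomposable proper submodule with `μ(Y) = μ(X) + 2^(-|Y|)`. -/
def IsGRSub {Y : Type v} [AddCommGroup Y] [Module Λ Y] (X : Submodule Λ Y) : Prop :=
  IndecMod Λ Y ∧ IndecSub Λ X ∧ X ≠ ⊤ ∧
    mu Λ (⊤ : Submodule Λ Y) = mu Λ X + (2 : ℝ) ^ (-(subLen Λ (⊤ : Submodule Λ Y) : ℤ))

/-- A map `u : X → Y` is a Gabriel-Roiter inclusion iff it is injective and its
image is a Gabriel-Roiter submodule of `Y`. -/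
def IsGRInclusion {X Y : Type v} [AddCommGroup X] [Module Λ X] [AddCommGroup Y] [Module Λ Y]
    (u : X →ₗ[Λ] Y) : Prop :=
  Function.Injective u ∧ IsGRSub Λ (LinearMap.range u)

/-- A linear map is a split monomorphism. -/
def IsSplitMonoHom {A B : Type v} [AddCommGroup A] [Module Λ A] [AddCommGroup B] [Module Λ B]
    (f : A →ₗ[Λ] B) : Prop :=
  ∃ g : B →ₗ[Λ] A, g.comp f = LinearMap.id

/-- A linear map is a split epimorphism. -/
def IsSplitEpiHom {A B : Type v} [AddCommGroup A] [Module Λ A] [AddCommGroup B] [Module Λ B]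
    (f : A →ₗ[Λ] B) : Prop :=
  ∃ g : B →ₗ[Λ] A, f.comp g = LinearMap.id

/-- A morphism `f` in the category of finite length `Λ`-modules is irreducible if it is
neither a split monomorphism nor a split epimorphism and, whenever `f = g ∘ h` with the
intermediate module of finite length, either `h` is a split monomorphism or `g` is a
split epimorphism. -/
def IsIrreducibleHom {A B : Type v} [AddCommGroup A] [Module Λ A] [AddCommGroup B] [Module Λ B]
    (f : A →ₗ[Λ] B) : Prop :=
  ¬ IsSplitMonoHom Λ f ∧ ¬ IsSplitEpiHom Λ f ∧
    ∀ (Z : Type v) [AddCommGroup Z] [Module Λ Z], IsFiniteLength Λ Z →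
      ∀ (h : A →ₗ[Λ] Z) (g : Z →ₗ[Λ] B), f = g.comp h →
        IsSplitMonoHom Λ h ∨ IsSplitEpiHom Λ g

/-- An indecomposable submodule `U` of the ambient module is piling provided
`μ(V) ≤ μ(U)` for every indecomposable submodule `V` with `|V| ≤ |U|`. -/
def IsPilingSub {Y : Type v} [AddCommGroup Y] [Module Λ Y] (U : Submodule Λ Y) : Prop :=
  IndecSub Λ U ∧ ∀ V : Submodule Λ Y, IndecSub Λ V →
    Order.height V ≤ Order.height U → mu Λ V ≤ mu Λ U

/-- A Gabriel-Roiter filtration `c 0 ⊂ c 1 ⊂ ⋯ ⊂ c t = N` of an (indecomposable)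
submodule `N`: a chain of indecomposable submodules starting at a simple module such
that each inclusion `c i ⊂ c (i+1)` is a Gabriel-Roiter inclusion,
i.e. `μ(c (i+1)) = μ(c i) + 2^(-|c (i+1)|)`. -/
def IsGRFiltration {Y : Type v} [AddCommGroup Y] [Module Λ Y] {t : ℕ}
    (c : Fin (t + 1) → Submodule Λ Y) (N : Submodule Λ Y) : Prop :=
  c (Fin.last t) = N ∧
  IsSimpleModule Λ (c 0) ∧
  (∀ i : Fin (t + 1), IndecSub Λ (c i)) ∧
  ∀ i : Fin t, c i.castSucc < c i.succ ∧
    mu Λ (c i.succ) = mu Λ (c i.castSucc) + (2 : ℝ) ^ (-(subLen Λ (c i.succ) : ℤ))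

/-- A brick: a nonzero module all of whose nonzero endomorphisms are invertible
(i.e. the endomorphism ring is a division ring). -/
def IsBrick (M : Type v) [AddCommGroup M] [Module Λ M] : Prop :=
  (∃ x : M, x ≠ 0) ∧ ∀ f : M →ₗ[Λ] M, f ≠ 0 → Function.Bijective f

/-- An `M`-filtration `0 = c 0 ⊂ c 1 ⊂ ⋯ ⊂ c m = Y` of the module `Y`
(so `c j` is the module `M[j]`, with `M[0] = 0`, and the `M`-length of `Y` is `m`):
all consecutive factors `c (i+1) / c i` are isomorphic to `M`. -/
structure IsMFiltration (M : Type v) [AddCommGroup M] [Module Λ M]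
    {Y : Type v} [AddCommGroup Y] [Module Λ Y] {m : ℕ}
    (c : Fin (m + 1) → Submodule Λ Y) : Prop where
  bot : c 0 = ⊥
  top : c (Fin.last m) = ⊤
  lt : ∀ i : Fin m, c i.castSucc < c i.succ
  quot : ∀ i : Fin m,
    Nonempty ((↥(c i.succ) ⧸ comap (c i.succ).subtype (c i.castSucc)) ≃ₗ[Λ] M)

/-- A homogeneous `M`-filtration: an `M`-filtration in which moreover all the
`M[i] = c i` with `i ≥ 1` are indecomposable and all the inclusions
`M[i-1] ⊂ M[i]` for `2 ≤ i ≤ m` are irreducible monomorphisms. -/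
structure IsHomogMFiltration (M : Type v) [AddCommGroup M] [Module Λ M]
    {Y : Type v} [AddCommGroup Y] [Module Λ Y] {m : ℕ}
    (c : Fin (m + 1) → Submodule Λ Y) extends IsMFiltration Λ M c : Prop where
  indec : ∀ i : Fin (m + 1), i ≠ 0 → IndecSub Λ (c i)
  irr : ∀ i : Fin m, (i : ℕ) ≠ 0 →
    IsIrreducibleHom Λ (Submodule.inclusion (toIsMFiltration.lt i).le)

end GRDefs

section Lattice

variable {Λ : Type u} [Ring Λ]
variable {Y : Type v} [AddCommGroup Y] [Module Λ Y]

theorem coe_subLen [IsNoetherian Λ Y] [IsArtinian Λ Y] (N : Submodule Λ Y) :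
    (subLen Λ N : ℕ∞) = Module.length Λ N := by
  rw [Module.length_submodule, subLen, ENat.natCast_toNat N.height_lt_top.ne]

theorem subLen_lt_subLen [IsNoetherian Λ Y] [IsArtinian Λ Y] {N P : Submodule Λ Y} (h : N < P) :
    subLen Λ N < subLen Λ P := by
  have := Submodule.height_strictMono h
  rw [← Module.length_submodule, ← Module.length_submodule, ← coe_subLen, ← coe_subLen] at this
  exact_mod_cast this

theorem subLen_eq_of_linearEquiv {Z : Type*} [AddCommGroup Z] [Module Λ Z]
    {N : Submodule Λ Y} {P : Submodule Λ Z} (e : N ≃ₗ[Λ] P) : subLen Λ N = subLen Λ P := by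
  rw [subLen, subLen, ← Module.length_submodule, ← Module.length_submodule, e.length_eq]

theorem map_eq_bot_iff_of_injective {Z : Type*} [AddCommGroup Z] [Module Λ Z] {f : Y →ₗ[Λ] Z}
    (hf : Function.Injective f) {N : Submodule Λ Y} : N.map f = ⊥ ↔ N = ⊥ := by
  rw [← (Submodule.map_injective_of_injective hf).eq_iff, Submodule.map_bot]

theorem IndecSub.map {Z : Type*} [AddCommGroup Z] [Module Λ Z] {f : Y →ₗ[Λ] Z}
    (hf : Function.Injective f) {N : Submodule Λ Y} (h : IndecSub Λ N) :
    IndecSub Λ (N.map f) := by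
  refine ⟨fun h0 => h.1 ((map_eq_bot_iff_of_injective hf).1 h0), fun A B hA hB hs hi => ?_⟩
  have eA : (A.comap f).map f = A := by
    rw [Submodule.map_comap_eq, inf_eq_right]
    exact hA.trans (LinearMap.map_le_range)
  have eB : (B.comap f).map f = B := by
    rw [Submodule.map_comap_eq, inf_eq_right]
    exact hB.trans (LinearMap.map_le_range)
  have inj := Submodule.map_injective_of_injective hf
  have := h.2 (A.comap f) (B.comap f)
    (by rwa [← Submodule.map_le_map_iff_of_injective hf, eA])
    (by rwa [← Submodule.map_le_map_iff_of_injective hf, eB])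
    (inj (by rw [Submodule.map_sup, eA, eB, hs]))
    (inj (by rw [Submodule.map_inf f hf, eA, eB, hi, Submodule.map_bot]))
  rwa [← map_eq_bot_iff_of_injective hf, ← map_eq_bot_iff_of_injective hf, eA, eB] at this

theorem IndecSub.of_map {Z : Type*} [AddCommGroup Z] [Module Λ Z] {f : Y →ₗ[Λ] Z}
    (hf : Function.Injective f) {N : Submodule Λ Y} (h : IndecSub Λ (N.map f)) :
    IndecSub Λ N := by
  refine ⟨fun h0 => h.1 (by rw [h0, Submodule.map_bot]), fun A B hA hB hs hi => ?_⟩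
  have := h.2 (A.map f) (B.map f) (Submodule.map_mono hA) (Submodule.map_mono hB)
    (by rw [← Submodule.map_sup, hs]) (by rw [← Submodule.map_inf f hf, hi, Submodule.map_bot])
  simpa only [map_eq_bot_iff_of_injective hf] using this

theorem indecSub_map_iff {Z : Type*} [AddCommGroup Z] [Module Λ Z] {f : Y →ₗ[Λ] Z}
    (hf : Function.Injective f) {N : Submodule Λ Y} : IndecSub Λ (N.map f) ↔ IndecSub Λ N :=
  ⟨.of_map hf, .map hf⟩

theorem indecMod_coe_iff {N : Submodule Λ Y} : IndecMod Λ N ↔ IndecSub Λ N := by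
  rw [IndecMod, ← indecSub_map_iff N.injective_subtype, Submodule.map_subtype_top]

theorem IndecMod.of_linearEquiv {Z : Type*} [AddCommGroup Z] [Module Λ Z] (e : Y ≃ₗ[Λ] Z)
    (h : IndecMod Λ Y) : IndecMod Λ Z := by
  have := IndecSub.map e.injective h
  rwa [Submodule.map_top, LinearMap.range_eq_top.2 e.surjective] at this

end Lattice

section Measure

variable {Λ : Type u} [Ring Λ]
variable {Y : Type v} [AddCommGroup Y] [Module Λ Y]

theorem setOf_lt_bot_eq_empty : {N' : Submodule Λ Y | N' < ⊥} = ∅ := by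
  ext; simp

theorem muAux_bot (n : ℕ) : muAux Λ n (⊥ : Submodule Λ Y) = 0 := by
  cases n with
  | zero => rfl
  | succ n =>
    rw [muAux, if_neg (fun h => h.1 rfl), setOf_lt_bot_eq_empty]
    simp

theorem mu_bot : mu Λ (⊥ : Submodule Λ Y) = 0 := muAux_bot _

variable [IsNoetherian Λ Y] [IsArtinian Λ Y]

theorem subLen_pos {N : Submodule Λ Y} (h : N ≠ ⊥) : 0 < subLen Λ N :=
  (Nat.zero_le _).trans_lt (subLen_lt_subLen (bot_lt_iff_ne_bot.2 h))

theorem muAux_eq_muAux (m n : ℕ) (N : Submodule Λ Y) (hm : subLen Λ N ≤ m) (hn : subLen Λ N ≤ n) :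
    muAux Λ m N = muAux Λ n N := by
  induction m generalizing n N with
  | zero =>
    have : N = ⊥ := by
      by_contra h
      have := subLen_pos h
      omega
    rw [this, muAux_bot, muAux_bot]
  | succ m ih =>
    cases n with
    | zero =>
      have : N = ⊥ := by
        by_contra h
        have := subLen_pos h
        omega
      rw [this, muAux_bot, muAux_bot]
    | succ n =>
      rw [muAux, muAux]
      congr 2
      refine Set.image_congr fun P hP => ?_
      have := subLen_lt_subLen hP
      exact ih n P (by omega) (by omega)

open Classical in
theorem mu_eq (N : Submodule Λ Y) :
    mu Λ N = (if IndecSub Λ N then (2 : ℝ) ^ (-(subLen Λ N : ℤ)) else 0)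
      + sSup (mu Λ '' {N' : Submodule Λ Y | N' < N}) := by
  rw [mu, muAux_eq_muAux _ (subLen Λ N + 1) N le_rfl (by omega), muAux]
  congr 2
  refine Set.image_congr fun P hP => ?_
  rw [mu]
  exact muAux_eq_muAux _ _ P (subLen_lt_subLen hP).le le_rfl

/-- Scaling by `2 ^ n` turns measures of submodules of length at most `n` into natural numbers. -/
theorem exists_mu_mul_pow_eq (N : Submodule Λ Y) (n : ℕ) (hn : subLen Λ N ≤ n) :
    ∃ a : ℕ, a < 2 ^ n ∧ mu Λ N * 2 ^ n = a := by
  induction n generalizing N with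
  | zero =>
    have : N = ⊥ := by
      by_contra h
      have := subLen_pos h
      omega
    exact ⟨0, by simp, by rw [this, mu_bot]; simp⟩
  | succ n ih =>
    by_cases hb : N = ⊥
    · exact ⟨0, by simp, by rw [hb, mu_bot]; simp⟩
    have fin : (mu Λ '' {N' : Submodule Λ Y | N' < N}).Finite := by
      refine (Set.finite_range fun i : Fin (2 ^ n) => ((i : ℕ) : ℝ) / 2 ^ n).subset ?_
      rintro _ ⟨P, hP, rfl⟩
      obtain ⟨a, ha, h⟩ := ih P (by have := subLen_lt_subLen hP; omega)
      exact ⟨⟨a, ha⟩, by simp only; rw [← h]; field_simp⟩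
    have ne : (mu Λ '' {N' : Submodule Λ Y | N' < N}).Nonempty :=
      ⟨_, ⊥, bot_lt_iff_ne_bot.2 hb, rfl⟩
    obtain ⟨P, hP, hPs⟩ := ne.csSup_mem fin
    rw [mu_eq, ← hPs]
    obtain ⟨a, ha, h⟩ := ih P (by have := subLen_lt_subLen hP; omega)
    split_ifs with hi
    · rcases hn.lt_or_eq with hlt | heq
      · obtain ⟨b, hb', h'⟩ := ih N (by omega)
        rw [mu_eq, ← hPs, if_pos hi] at h'
        exact ⟨2 * b, by rw [pow_succ]; omega, by push_cast; rw [← h']; ring⟩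
      · refine ⟨1 + 2 * a, by rw [pow_succ]; omega, ?_⟩
        push_cast
        rw [← h, heq, zpow_neg, zpow_natCast]
        field_simp
        ring
    · exact ⟨2 * a, by rw [pow_succ]; omega, by push_cast; rw [← h]; ring⟩

theorem finite_mu_image (N : Submodule Λ Y) :
    (mu Λ '' {N' : Submodule Λ Y | N' < N}).Finite := by
  refine (Set.finite_range fun i : Fin (2 ^ subLen Λ N) =>
    ((i : ℕ) : ℝ) / 2 ^ subLen Λ N).subset ?_
  rintro _ ⟨P, hP, rfl⟩
  obtain ⟨a, ha, h⟩ := exists_mu_mul_pow_eq P _ (subLen_lt_subLen hP).le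
  exact ⟨⟨a, ha⟩, by simp only; rw [← h]; field_simp⟩

theorem mu_le_sSup {N P : Submodule Λ Y} (h : P < N) :
    mu Λ P ≤ sSup (mu Λ '' {N' : Submodule Λ Y | N' < N}) :=
  le_csSup (finite_mu_image N).bddAbove ⟨P, h, rfl⟩

theorem mu_mono {N P : Submodule Λ Y} (h : P ≤ N) : mu Λ P ≤ mu Λ N := by
  rcases h.lt_or_eq with h | rfl
  · rw [mu_eq N]
    have := mu_le_sSup h
    have : (0 : ℝ) < 2 ^ (-(subLen Λ N : ℤ)) := by positivity
    split_ifs <;> linarith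
  · exact le_rfl

theorem IndecSub.mu_add_le {N P : Submodule Λ Y} (hN : IndecSub Λ N) (h : P < N) :
    mu Λ P + (2 : ℝ) ^ (-(subLen Λ N : ℤ)) ≤ mu Λ N := by
  rw [mu_eq N, if_pos hN]
  linarith [mu_le_sSup h]

theorem IndecSub.mu_lt {N P : Submodule Λ Y} (hN : IndecSub Λ N) (h : P < N) :
    mu Λ P < mu Λ N := by
  have := hN.mu_add_le h
  have : (0 : ℝ) < 2 ^ (-(subLen Λ N : ℤ)) := by positivity
  linarith

theorem exists_lt_mu_eq_sSup {N : Submodule Λ Y} (h : N ≠ ⊥) :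
    ∃ P < N, mu Λ P = sSup (mu Λ '' {N' : Submodule Λ Y | N' < N}) := by
  have ne : (mu Λ '' {N' : Submodule Λ Y | N' < N}).Nonempty :=
    ⟨_, ⊥, bot_lt_iff_ne_bot.2 h, rfl⟩
  obtain ⟨P, hP, e⟩ := ne.csSup_mem (finite_mu_image N)
  exact ⟨P, hP, e⟩

/-- The measure of a nonzero submodule is attained on an indecomposable submodule. -/
theorem exists_indecSub_mu_eq (N : Submodule Λ Y) (h : N ≠ ⊥) :
    ∃ P ≤ N, IndecSub Λ P ∧ mu Λ P = mu Λ N := by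
  induction N using WellFoundedLT.induction with
  | ind N ih =>
    by_cases hi : IndecSub Λ N
    · exact ⟨N, le_rfl, hi, rfl⟩
    obtain ⟨P, hP, e⟩ := exists_lt_mu_eq_sSup h
    have e' : mu Λ P = mu Λ N := by rw [mu_eq N, if_neg hi, e, zero_add]
    have key : ∃ Q < N, Q ≠ ⊥ ∧ mu Λ Q = mu Λ N := by
      by_cases hb : P = ⊥
      · have : ∃ Q < N, Q ≠ ⊥ := by
          by_contra! hc
          refine hi ⟨h, fun A B hA hB hs hAB => ?_⟩
          rcases hA.lt_or_eq with hA | rfl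
          · exact .inl (hc A hA)
          · exact .inr (by rwa [inf_eq_right.2 hB] at hAB)
        obtain ⟨Q, hQ, hQ0⟩ := this
        exact ⟨Q, hQ, hQ0, le_antisymm (mu_mono hQ.le) (by
          rw [← e', hb]; exact mu_mono bot_le)⟩
      · exact ⟨P, hP, hb, e'⟩
    obtain ⟨Q, hQ, hQ0, e⟩ := key
    obtain ⟨P, hPQ, hP, e'⟩ := ih Q hQ hQ0
    exact ⟨P, hPQ.trans hQ.le, hP, e'.trans e⟩

theorem mu_map {Z : Type v} [AddCommGroup Z] [Module Λ Z] [IsNoetherian Λ Z] [IsArtinian Λ Z]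
    {f : Y →ₗ[Λ] Z} (hf : Function.Injective f) (N : Submodule Λ Y) :
    mu Λ (N.map f) = mu Λ N := by
  induction N using WellFoundedLT.induction with
  | ind N ih =>
    have hset : {P : Submodule Λ Z | P < N.map f} = Submodule.map f '' {P | P < N} := by
      ext P
      constructor
      · intro hP
        have e : (P.comap f).map f = P := by
          rw [Submodule.map_comap_eq, inf_eq_right]
          exact hP.le.trans (LinearMap.map_le_range)
        refine ⟨P.comap f, ?_, e⟩
        change P < N.map f at hP
        rw [← e] at hP
        exact lt_of_le_not_ge ((Submodule.map_le_map_iff_of_injective hf _ _).1 hP.le)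
          fun h => hP.not_ge (Submodule.map_mono h)
      · rintro ⟨Q, hQ, rfl⟩
        exact Submodule.map_strictMono_of_injective hf hQ
    rw [mu_eq, mu_eq N, hset, Set.image_image,
      subLen_eq_of_linearEquiv (Submodule.equivMapOfInjective f hf N).symm]
    congr 1
    · classical exact if_congr (indecSub_map_iff hf) rfl rfl
    congr 1
    exact Set.image_congr fun P hP => ih P hP

theorem mu_range {Z : Type v} [AddCommGroup Z] [Module Λ Z] [IsNoetherian Λ Z] [IsArtinian Λ Z]
    {f : Y →ₗ[Λ] Z} (hf : Function.Injective f) : mu Λ (LinearMap.range f) = muMod Λ Y := by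
  rw [← Submodule.map_top, mu_map hf, muMod]

theorem muMod_coe (N : Submodule Λ Y) : muMod Λ N = mu Λ N := by
  rw [← mu_range N.injective_subtype, Submodule.range_subtype]

end Measure

section Decomposition

variable {Λ : Type u} [Ring Λ]

/-- Splitting off a decomposition of the range of an idempotent endomorphism. -/
theorem exists_isIdempotentElem_range_le {E : Type v} [AddCommGroup E] [Module Λ E]
    {e : Module.End Λ E} (he : IsIdempotentElem e) {A B : Submodule Λ E}
    (hs : A ⊔ B = LinearMap.range e) (hi : A ⊓ B = ⊥) :
    ∃ p : Module.End Λ E, IsIdempotentElem p ∧ IsIdempotentElem (e - p) ∧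
      LinearMap.range p ≤ A ∧ LinearMap.range (e - p) ≤ B := by
  have hA : A ≤ LinearMap.range e := hs ▸ le_sup_left
  have hB : B ≤ LinearMap.range e := hs ▸ le_sup_right
  have he' : ∀ x, e (e x) = e x := fun x => LinearMap.congr_fun he x
  have fixe : ∀ x ∈ LinearMap.range e, e x = x := by
    rintro _ ⟨y, rfl⟩
    exact he' y
  have hc : IsCompl A (B ⊔ LinearMap.ker e) := by
    constructor
    · rw [Submodule.disjoint_def]
      intro x hxA hx
      obtain ⟨b, hb, k, hk, rfl⟩ := Submodule.mem_sup.1 hx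
      have h1 := fixe _ (hA hxA)
      rw [map_add, LinearMap.mem_ker.1 hk, add_zero, fixe b (hB hb), left_eq_add] at h1
      rw [h1, add_zero] at hxA ⊢
      have : b ∈ A ⊓ B := ⟨hxA, hb⟩
      rwa [hi, Submodule.mem_bot] at this
    · rw [codisjoint_iff, ← sup_assoc, hs, eq_top_iff]
      rintro x -
      rw [show x = e x + (x - e x) by abel]
      refine Submodule.add_mem_sup ⟨x, rfl⟩ ?_
      rw [LinearMap.mem_ker, map_sub, he', sub_self]
  set p := A.projection _ hc with hp
  have pA : ∀ x, p x ∈ A := fun x => Submodule.projection_apply_mem hc x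
  have fixp : ∀ x ∈ A, p x = x := fun x hx => Submodule.projection_apply_of_mem_left hc hx
  have kill : ∀ x ∈ B ⊔ LinearMap.ker e, p x = 0 := fun x hx =>
    (Submodule.projection_apply_eq_zero_iff hc).2 hx
  have hpe : ∀ x, p (e x) = p x := by
    intro x
    have := kill (x - e x) (Submodule.mem_sup_right (by
      rw [LinearMap.mem_ker, map_sub, he', sub_self]))
    rwa [map_sub, sub_eq_zero, eq_comm] at this
  have hep : ∀ x, e (p x) = p x := fun x => fixe _ (hA (pA x))
  have hpp : ∀ x, p (p x) = p x := fun x => fixp _ (pA x)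
  refine ⟨p, LinearMap.ext hpp, LinearMap.ext fun x => ?_, ?_, ?_⟩
  · change (e - p) ((e - p) x) = (e - p) x
    simp only [LinearMap.sub_apply, map_sub, he', hpe, hep, hpp]
    abel
  · rintro _ ⟨x, rfl⟩
    exact pA x
  · rintro _ ⟨x, rfl⟩
    have hx : e x ∈ A ⊔ B := hs ▸ ⟨x, rfl⟩
    obtain ⟨a, ha, b, hb, h⟩ := Submodule.mem_sup.1 hx
    rw [LinearMap.sub_apply, ← hpe, ← h, map_add, fixp a ha, kill b (Submodule.mem_sup_left hb),
      add_zero, add_sub_cancel_left]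
    exact hb

theorem exists_list_isIdempotentElem_sum_eq {E : Type v} [AddCommGroup E] [Module Λ E]
    [IsArtinian Λ E] (e : Module.End Λ E) (he : IsIdempotentElem e) :
    ∃ l : List (Module.End Λ E),
      (∀ p ∈ l, IsIdempotentElem p ∧ IndecSub Λ (LinearMap.range p)) ∧ l.sum = e := by
  induction hN : LinearMap.range e using WellFoundedLT.induction generalizing e with
  | ind N ih =>
    subst hN
    by_cases h0 : LinearMap.range e = ⊥
    · exact ⟨[], by simp, by rw [LinearMap.range_eq_bot.1 h0]; rfl⟩
    by_cases hi : IndecSub Λ (LinearMap.range e)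
    · exact ⟨[e], by simpa using ⟨he, hi⟩, by simp⟩
    have : ∃ A B : Submodule Λ E, A ≤ LinearMap.range e ∧ B ≤ LinearMap.range e ∧
        A ⊔ B = LinearMap.range e ∧ A ⊓ B = ⊥ ∧ A ≠ ⊥ ∧ B ≠ ⊥ := by
      by_contra! hc
      refine hi ⟨h0, fun A B hA hB hs hAB => ?_⟩
      by_contra! h
      exact h.2 (hc A B hA hB hs hAB h.1)
    obtain ⟨A, B, hA, hB, hs, hAB, hA0, hB0⟩ := this
    obtain ⟨p, hp, hp', hpA, hpB⟩ := exists_isIdempotentElem_range_le he hs hAB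
    have hA' : A < LinearMap.range e := by
      refine hA.lt_of_ne fun h => hB0 ?_
      rwa [h, inf_eq_right.2 hB] at hAB
    have hB' : B < LinearMap.range e := by
      refine hB.lt_of_ne fun h => hA0 ?_
      rwa [h, inf_eq_left.2 hA] at hAB
    obtain ⟨l, hl, hls⟩ := ih _ (hpA.trans_lt hA') p hp rfl
    obtain ⟨l', hl', hls'⟩ := ih _ (hpB.trans_lt hB') (e - p) hp' rfl
    refine ⟨l ++ l', fun q hq => ?_, by rw [List.sum_append, hls, hls']; abel⟩
    rcases List.mem_append.1 hq with hq | hq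
    exacts [hl q hq, hl' q hq]

theorem IndecMod.eq_top_of_isSplitMonoHom_subtype {X : Type v} [AddCommGroup X] [Module Λ X]
    (hX : IndecMod Λ X) {P : Submodule Λ X} (hP : P ≠ ⊥) (h : IsSplitMonoHom Λ P.subtype) :
    P = ⊤ := by
  obtain ⟨r, hr⟩ := h
  have hc : IsCompl P (LinearMap.ker r) :=
    LinearMap.isCompl_of_proj fun x => LinearMap.congr_fun hr x
  rcases hX.2 P (LinearMap.ker r) le_top le_top hc.sup_eq_top hc.inf_eq_bot with h | h
  · exact absurd h hP
  · have := hc.sup_eq_top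
    rwa [h, sup_bot_eq] at this

end Decomposition

section MainProperty

variable {Λ : Type u} [Ring Λ]

/-- Every jointly injective family of maps out of `X` whose ranges have measure at most that of
`X` contains an injective map. -/
def DetectsInjective (Λ : Type u) [Ring Λ] (X : Type v) [AddCommGroup X] [Module Λ X] : Prop :=
  ∀ (ι : Type v) (V : ι → Type v) [∀ i, AddCommGroup (V i)] [∀ i, Module Λ (V i)]
    [∀ i, IsNoetherian Λ (V i)] [∀ i, IsArtinian Λ (V i)] (f : ∀ i, X →ₗ[Λ] V i),
    (∀ x, (∀ i, f i x = 0) → x = 0) → (∀ i, mu Λ (LinearMap.range (f i)) ≤ muMod Λ X) →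
    ∃ i, Function.Injective (f i)

theorem DetectsInjective.exists_isSplitMonoHom {X : Type v} [AddCommGroup X] [Module Λ X]
    [IsNoetherian Λ X] [IsArtinian Λ X] (hX : DetectsInjective Λ X)
    (ι : Type v) (V : ι → Type v) [∀ i, AddCommGroup (V i)] [∀ i, Module Λ (V i)]
    [∀ i, IsNoetherian Λ (V i)] [∀ i, IsArtinian Λ (V i)] (f : ∀ i, X →ₗ[Λ] V i)
    (hf : ∀ x, (∀ i, f i x = 0) → x = 0) (hmu : ∀ i, muMod Λ (V i) ≤ muMod Λ X) :
    ∃ i, IsSplitMonoHom Λ (f i) := by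
  choose l hl hls using fun i =>
    exists_list_isIdempotentElem_sum_eq (1 : Module.End Λ (V i)) IsIdempotentElem.one
  have joint : ∀ x, (∀ j : Σ i, {p : Module.End Λ (V i) // p ∈ l i}, j.2.1 (f j.1 x) = 0) →
      x = 0 := by
    intro x hx
    refine hf x fun i => ?_
    have : ∀ l' : List (Module.End Λ (V i)), (∀ p ∈ l', p (f i x) = 0) → l'.sum (f i x) = 0 := by
      intro l' h
      induction l' with
      | nil => simp
      | cons a t ih => simp_all
    have h1 := this (l i) fun p hp => hx ⟨i, p, hp⟩
    rwa [hls] at h1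
  obtain ⟨⟨i, p, hp⟩, hinj⟩ := hX (Σ i, {p : Module.End Λ (V i) // p ∈ l i}) (fun j => V j.1)
    (fun j => j.2.1.comp (f j.1)) joint
    (fun j => (mu_mono le_top).trans (hmu j.1))
  have le : LinearMap.range (p.comp (f i)) ≤ LinearMap.range p :=
    LinearMap.range_comp_le_range _ _
  have hr : LinearMap.range (p.comp (f i)) = LinearMap.range p := by
    by_contra hne
    have h1 := (hl i p hp).2.mu_lt (le.lt_of_ne hne)
    rw [mu_range hinj] at h1
    have h2 : mu Λ (LinearMap.range p) ≤ muMod Λ (V i) := mu_mono le_top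
    linarith [hmu i]
  refine ⟨i, (LinearEquiv.ofInjective _ hinj).symm.toLinearMap.comp
    (p.codRestrict (LinearMap.range (p.comp (f i))) fun v => hr ▸ ⟨v, rfl⟩), ?_⟩
  ext x
  simp only [LinearMap.comp_apply, LinearEquiv.coe_coe, LinearMap.id_apply]
  rw [LinearEquiv.symm_apply_eq]
  rfl

variable {X : Type v} [AddCommGroup X] [Module Λ X] [IsNoetherian Λ X] [IsArtinian Λ X]

theorem exists_indecSub_lt_mu_eq_sSup {N Q : Submodule Λ X} (hQ : Q < N) (hQ0 : Q ≠ ⊥) :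
    ∃ P < N, IndecSub Λ P ∧ mu Λ P = sSup (mu Λ '' {N' : Submodule Λ X | N' < N}) := by
  obtain ⟨P, hP, e⟩ := exists_lt_mu_eq_sSup (bot_lt_of_lt hQ).ne'
  obtain ⟨P', hP', hP0, e'⟩ : ∃ P' < N, P' ≠ ⊥ ∧ mu Λ P' = mu Λ P := by
    by_cases hb : P = ⊥
    · refine ⟨Q, hQ, hQ0, le_antisymm ?_ ?_⟩
      · rw [e]
        exact mu_le_sSup hQ
      · rw [hb]
        exact mu_mono bot_le
    · exact ⟨P, hP, hb, rfl⟩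
  obtain ⟨R, hR, hRi, hR'⟩ := exists_indecSub_mu_eq P' hP0
  exact ⟨R, hR.trans_lt hP', hRi, by rw [hR', e', e]⟩

theorem subLen_range_lt {Z : Type v} [AddCommGroup Z] [Module Λ Z] [IsNoetherian Λ Z]
    [IsArtinian Λ Z] {f : X →ₗ[Λ] Z} (hf : ¬ Function.Injective f) :
    subLen Λ (LinearMap.range f) < subLen Λ (⊤ : Submodule Λ X) := by
  have h : Module.length Λ (X ⧸ LinearMap.ker f) < Module.length Λ X :=
    Submodule.length_quotient_lt _ (fun h => hf (LinearMap.ker_eq_bot.1 h))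
  rw [f.quotKerEquivRange.length_eq, ← Module.length_top (R := Λ) (M := X), ← coe_subLen,
    ← coe_subLen] at h
  exact_mod_cast h

theorem detectsInjective_of_forall_lt (hX : IndecMod Λ X)
    (ih : ∀ P : Submodule Λ X, P < ⊤ → IndecSub Λ P → DetectsInjective Λ P) :
    DetectsInjective Λ X := by
  intro ι V _ _ _ _ f hf hmu
  by_contra! hne
  by_cases hQ : ∃ Q : Submodule Λ X, Q < ⊤ ∧ Q ≠ ⊥
  · obtain ⟨Q, hQ, hQ0⟩ := hQ
    obtain ⟨P, hP, hPi, hPs⟩ := exists_indecSub_lt_mu_eq_sSup hQ hQ0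
    have hmuX : muMod Λ X = 2 ^ (-(subLen Λ (⊤ : Submodule Λ X) : ℤ)) + mu Λ P := by
      rw [muMod, mu_eq, if_pos (show IndecSub Λ (⊤ : Submodule Λ X) from hX), hPs]
    by_cases hle : ∀ i, mu Λ (LinearMap.range (f i)) ≤ mu Λ P
    · obtain ⟨i, r, hr⟩ := (ih P hP hPi).exists_isSplitMonoHom ι
        (fun i => LinearMap.range (f i)) (fun i => (f i).rangeRestrict.comp P.subtype)
        (fun x hx => Subtype.ext (hf x fun i => congrArg Subtype.val (hx i)))
        (fun i => by rw [muMod_coe, muMod_coe]; exact hle i)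
      exact hP.ne (hX.eq_top_of_isSplitMonoHom_subtype hPi.1
        ⟨r.comp (f i).rangeRestrict, hr⟩)
    · push Not at hle
      obtain ⟨j, hj⟩ := hle
      have hL := subLen_range_lt (hne j)
      have hL' := subLen_lt_subLen hP
      obtain ⟨n, hn⟩ : ∃ n, subLen Λ (⊤ : Submodule Λ X) = n + 1 :=
        Nat.exists_eq_succ_of_ne_zero (by omega)
      obtain ⟨a, -, ha⟩ := exists_mu_mul_pow_eq P n (by omega)
      obtain ⟨b, -, hb⟩ := exists_mu_mul_pow_eq (LinearMap.range (f j)) n (by omega)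
      have hpos : (0 : ℝ) < 2 ^ n := by positivity
      have hab : a < b := by
        have := mul_lt_mul_of_pos_right hj hpos
        rw [ha, hb] at this
        exact_mod_cast this
      have hab' : (a : ℝ) + 1 ≤ b := by exact_mod_cast hab
      have h1 := mul_le_mul_of_nonneg_right (hmu j) hpos.le
      rw [hmuX, hn, add_mul, ha, hb, zpow_neg, zpow_natCast, pow_succ, mul_inv, mul_assoc,
        mul_comm _ ((2 : ℝ) ^ n), ← mul_assoc, inv_mul_cancel₀ hpos.ne'] at h1
      linarith
  · push Not at hQ
    obtain ⟨x, -, hx⟩ := Submodule.exists_mem_ne_zero_of_ne_bot hX.1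
    have : ∃ i, f i x ≠ 0 := by
      by_contra! h
      exact hx (hf x h)
    obtain ⟨i, hi⟩ := this
    refine hne i (LinearMap.ker_eq_bot.1 (hQ _ (lt_top_iff_ne_top.2 fun h => hi ?_)))
    rw [← LinearMap.mem_ker, h]
    trivial

theorem DetectsInjective.of_linearEquiv {Z : Type v} [AddCommGroup Z] [Module Λ Z]
    [IsNoetherian Λ Z] [IsArtinian Λ Z] (e : X ≃ₗ[Λ] Z) (h : DetectsInjective Λ X) :
    DetectsInjective Λ Z := by
  intro ι V _ _ _ _ f hf hmu
  have hr : ∀ i, LinearMap.range ((f i).comp e.toLinearMap) = LinearMap.range (f i) := fun i =>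
    LinearMap.range_comp_of_range_eq_top _ (LinearMap.range_eq_top.2 e.surjective)
  have hZ : muMod Λ Z = muMod Λ X := by
    rw [← mu_range (f := e.toLinearMap) e.injective, LinearMap.range_eq_top.2 e.surjective, muMod]
  obtain ⟨i, hi⟩ := h ι V (fun i => (f i).comp e.toLinearMap)
    (fun x hx => e.map_eq_zero_iff.1 (hf _ hx)) (fun i => by rw [hr, ← hZ]; exact hmu i)
  refine ⟨i, fun x y hxy => ?_⟩
  have := hi (a₁ := e.symm x) (a₂ := e.symm y) (by simpa using hxy)
  exact e.symm.injective this

theorem detectsInjective_submodule (N : Submodule Λ X) (hN : IndecSub Λ N) :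
    DetectsInjective Λ N := by
  induction N using WellFoundedLT.induction with
  | ind N ih =>
    refine detectsInjective_of_forall_lt (indecMod_coe_iff.2 hN) fun P hP hPi => ?_
    have hlt : P.map N.subtype < N := by
      have := Submodule.map_strictMono_of_injective N.injective_subtype hP
      rwa [Submodule.map_subtype_top] at this
    exact (ih _ hlt (hPi.map N.injective_subtype)).of_linearEquiv
      (Submodule.equivMapOfInjective _ N.injective_subtype P).symm

theorem IndecMod.detectsInjective (hX : IndecMod Λ X) : DetectsInjective Λ X :=
  (detectsInjective_submodule ⊤ hX).of_linearEquiv Submodule.topEquiv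

/-- Gabriel's main property: an embedding of an indecomposable module into a module of no larger
measure splits. -/
theorem IndecMod.isSplitMonoHom_of_muMod_le (hX : IndecMod Λ X) {V : Type v} [AddCommGroup V]
    [Module Λ V] [IsNoetherian Λ V] [IsArtinian Λ V] {f : X →ₗ[Λ] V} (hf : Function.Injective f)
    (h : muMod Λ V ≤ muMod Λ X) : IsSplitMonoHom Λ f := by
  obtain ⟨_, h⟩ := hX.detectsInjective.exists_isSplitMonoHom PUnit (fun _ => V) (fun _ => f)
    (fun x hx => hf (by rw [hx ⟨⟩, map_zero])) (fun _ => h)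
  exact h

end MainProperty

section Duality

/-- A minimal injective cogenerator over a commutative ring: an injective module whose
`𝔪`-torsion is, for every maximal ideal `𝔪`, a one-dimensional `k ⧸ 𝔪`-space. -/
structure IsDualizing (k : Type u) [CommRing k] (I : Type u) [AddCommGroup I] [Module k I] :
    Prop where
  baer : Module.Baer k I
  exists_generator : ∀ m : Ideal k, m.IsMaximal → ∃ x : I, x ≠ 0 ∧ (∀ a ∈ m, a • x = 0) ∧
    ∀ y : I, (∀ a ∈ m, a • y = 0) → ∃ b : k, y = b • x

theorem exists_maximal_disjoint {k J : Type*} [Ring k] [AddCommGroup J] [Module k J]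
    (N P : Submodule k J) (h : Disjoint P N) : ∃ C, P ≤ C ∧ Maximal (fun Q => Disjoint Q N) C := by
  refine zorn_le_nonempty₀ {Q : Submodule k J | Disjoint Q N} (fun c hc hch Q hQ =>
    ⟨sSup c, ?_, fun z hz => le_sSup hz⟩) P h
  change Disjoint (sSup c) N
  rw [Submodule.disjoint_def]
  intro x hx hxN
  obtain ⟨R, hR, hxR⟩ := (Submodule.mem_sSup_of_directed ⟨Q, hQ⟩ hch.directedOn).1 hx
  exact Submodule.disjoint_def.1 (hc hR) x hxR hxN

theorem exists_injective_baer (k : Type u) [CommRing k] (S : Type u) [AddCommGroup S]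
    [Module k S] : ∃ (J : Type u) (_ : AddCommGroup J) (_ : Module k J) (f : S →ₗ[k] J),
      Module.Baer k J ∧ Function.Injective f := by
  obtain ⟨p⟩ := CategoryTheory.EnoughInjectives.presentation (ModuleCat.of k S)
  have := p.injective
  have hJ : Module.Injective k p.J := Module.injective_module_of_injective_object k p.J
  exact ⟨p.J, inferInstance, inferInstance, p.f.hom, Module.Baer.of_injective hJ,
    (ModuleCat.mono_iff_injective p.f).1 p.mono⟩

/-- Injective hulls, in the form of an essential extension which is injective. -/
theorem exists_essential_baer (k : Type u) [CommRing k] (S : Type u) [AddCommGroup S]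
    [Module k S] : ∃ (I : Type u) (_ : AddCommGroup I) (_ : Module k I) (f : S →ₗ[k] I),
      Module.Baer k I ∧ Function.Injective f ∧ ∀ y : I, y ≠ 0 → ∃ (a : k) (s : S), s ≠ 0 ∧
        a • y = f s := by
  obtain ⟨J, _, _, ι, hJ, hι⟩ := exists_injective_baer k S
  obtain ⟨C, -, hC⟩ := exists_maximal_disjoint (LinearMap.range ι) ⊥ disjoint_bot_left
  obtain ⟨N, hSN, hN⟩ := exists_maximal_disjoint C (LinearMap.range ι) hC.1.symm
  have hdis := Submodule.disjoint_def.1 hC.1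
  have hdisN := Submodule.disjoint_def.1 hN.1
  have ess : ∀ y : J ⧸ C, y ≠ 0 → ∃ (a : k) (s : S), s ≠ 0 ∧ a • y = C.mkQ (ι s) := by
    intro y hy
    obtain ⟨y, rfl⟩ := C.mkQ_surjective y
    have hyC : y ∉ C := fun h => hy ((Submodule.Quotient.mk_eq_zero C).2 h)
    have hnd : ¬ Disjoint (C ⊔ Submodule.span k {y}) (LinearMap.range ι) := fun h =>
      hyC (hC.2 h le_sup_left (Submodule.mem_sup_right (Submodule.mem_span_singleton_self y)))
    rw [Submodule.disjoint_def] at hnd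
    push Not at hnd
    obtain ⟨_, hx, ⟨s, rfl⟩, hs⟩ := hnd
    obtain ⟨c, hc, z, hz, h⟩ := Submodule.mem_sup.1 hx
    obtain ⟨a, rfl⟩ := Submodule.mem_span_singleton.1 hz
    refine ⟨a, s, fun h => hs (by rw [h, map_zero]), ?_⟩
    rw [← h, map_add, show C.mkQ c = 0 from (Submodule.Quotient.mk_eq_zero C).2 hc, zero_add,
      map_smul]
  have hmk : Function.Injective (C.mkQ.comp N.subtype) := by
    rw [← LinearMap.ker_eq_bot, LinearMap.ker_eq_bot']
    exact fun n hn => Subtype.ext (hdisN n n.2 ((Submodule.Quotient.mk_eq_zero C).1 hn))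
  obtain ⟨g, hg⟩ := hJ.extension_property (C.mkQ.comp N.subtype) hmk N.subtype
  have hgN : ∀ n ∈ N, g (C.mkQ n) = n := fun n hn => LinearMap.congr_fun hg ⟨n, hn⟩
  have hgι : ∀ s, g (C.mkQ (ι s)) = ι s := fun s => hgN _ (hSN ⟨s, rfl⟩)
  have hginj : Function.Injective g := by
    rw [← LinearMap.ker_eq_bot, LinearMap.ker_eq_bot']
    intro y hy
    by_contra h
    obtain ⟨a, s, hs, e⟩ := ess y h
    have := congrArg g e
    rw [map_smul, hy, smul_zero, hgι] at this
    exact hs (hι (by rw [← this, map_zero]))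
  have hgr : LinearMap.range g ≤ N := by
    refine hN.2 ?_ fun n hn => ⟨_, hgN n hn⟩
    refine Submodule.disjoint_def.2 ?_
    rintro _ ⟨y, rfl⟩ hy
    by_contra h
    obtain ⟨a, s, hs, e⟩ := ess y (fun h0 => h (by rw [h0, map_zero]))
    have := congrArg g e
    rw [map_smul, hgι] at this
    exact hs (hι (by rw [map_zero]; exact hdis _ (this ▸ C.smul_mem a hy) ⟨s, rfl⟩))
  have hmkg : ∀ y, C.mkQ (g y) = y := fun y => hginj (hgN _ (hgr ⟨y, rfl⟩))
  refine ⟨J ⧸ C, inferInstance, inferInstance, C.mkQ.comp ι, ?_, ?_, ess⟩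
  · intro A f
    obtain ⟨f', hf'⟩ := hJ A (g.comp f)
    exact ⟨C.mkQ.comp f', fun x hx => by
      rw [LinearMap.comp_apply, hf' x hx, LinearMap.comp_apply, hmkg]⟩
  · intro s t hst
    have := congrArg g hst
    rw [LinearMap.comp_apply, LinearMap.comp_apply, hgι, hgι] at this
    exact hι this

theorem exists_isDualizing (k : Type u) [CommRing k] :
    ∃ (I : Type u) (_ : AddCommGroup I) (_ : Module k I), IsDualizing k I := by
  classical
  obtain ⟨I, _, _, f, hI, hf, ess⟩ :=
    exists_essential_baer k (∀ m : MaximalSpectrum k, k ⧸ m.asIdeal)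
  refine ⟨I, inferInstance, inferInstance, hI, fun m hm => ?_⟩
  have tors : ∀ (n : Ideal k) (a : k) (z : k ⧸ n), a ∈ n → a • z = 0 := fun n a z ha => by
    rw [Algebra.smul_def]
    exact (congrArg (· * z) (Ideal.Quotient.eq_zero_iff_mem.2 ha)).trans (zero_mul z)
  let x : ∀ m : MaximalSpectrum k, k ⧸ m.asIdeal := Pi.single ⟨m, hm⟩ 1
  have hxm : x ⟨m, hm⟩ = 1 := Pi.single_eq_same _ _
  have hx : ∀ y : ∀ m : MaximalSpectrum k, k ⧸ m.asIdeal, (∀ a ∈ m, a • y = 0) →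
      ∃ b : k, y = b • x := by
    intro y hy
    obtain ⟨b, hb⟩ := Ideal.Quotient.mk_surjective (y ⟨m, hm⟩)
    refine ⟨b, funext fun n => ?_⟩
    by_cases hn : n = ⟨m, hm⟩
    · subst hn
      rw [Pi.smul_apply, hxm, Algebra.smul_def, mul_one, ← hb]
      rfl
    · have hne : m ⊔ n.asIdeal = ⊤ := hm.coprime_of_ne n.isMaximal fun h =>
        hn (MaximalSpectrum.ext h.symm)
      obtain ⟨a, ha, c, hc, hac⟩ := Submodule.mem_sup.1 ((Ideal.eq_top_iff_one _).1 hne)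
      rw [Pi.smul_apply, show x n = 0 from Pi.single_eq_of_ne hn _, smul_zero, ← one_smul k (y n),
        ← hac, add_smul, tors _ c _ hc, ← Pi.smul_apply, hy a ha, Pi.zero_apply, add_zero]
  have hmx : ∀ a ∈ m, a • x = 0 := by
    intro a ha
    funext n
    by_cases hn : n = ⟨m, hm⟩
    · subst hn
      exact tors m a _ ha
    · rw [Pi.smul_apply, show x n = 0 from Pi.single_eq_of_ne hn _, smul_zero, Pi.zero_apply]
  refine ⟨f x, fun h => ?_, fun a ha => by rw [← map_smul, hmx a ha, map_zero], fun y hy => ?_⟩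
  · have h0 : x = 0 := hf (by rw [h, map_zero])
    rw [h0, Pi.zero_apply] at hxm
    exact hm.ne_top ((Ideal.eq_top_iff_one _).2 (Ideal.Quotient.eq_zero_iff_mem.1 hxm.symm))
  · by_cases hy0 : y = 0
    · exact ⟨0, by rw [hy0, zero_smul]⟩
    obtain ⟨a, s, hs, e⟩ := ess y hy0
    have ham : a ∉ m := fun h => hs (hf (by rw [← e, hy a h, map_zero]))
    obtain ⟨b, c, hc, hbc⟩ := hm.exists_inv ham
    have hys : y = f (b • s) := by
      rw [map_smul, ← e, smul_smul, ← add_zero ((b * a) • y), ← hy c hc, ← add_smul, hbc, one_smul]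
    obtain ⟨d, hd⟩ := hx (b • s) fun a' ha' => hf (by rw [map_smul, ← hys, hy a' ha', map_zero])
    exact ⟨d, by rw [hys, hd, map_smul]⟩

variable {k : Type u} [CommRing k] {I : Type u} [AddCommGroup I] [Module k I]

theorem IsDualizing.length_dual_le (hI : IsDualizing k I) {V : Type*} [AddCommGroup V]
    [Module k V] (hV : IsFiniteLength k V) :
    Module.length k (V →ₗ[k] I) ≤ Module.length k V := by
  induction hV with
  | of_subsingleton =>
    rw [Module.length_eq_zero]
    exact zero_le
  | @of_simple_quotient V _ _ N hs _ ih =>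
    have h1 : Module.length k ((V ⧸ N) →ₗ[k] I) ≤ 1 := by
      obtain ⟨m, hm, ⟨e⟩⟩ := isSimpleModule_iff_quot_maximal.1 hs
      obtain ⟨x, -, hmx, hx⟩ := hI.exists_generator m hm
      have : IsSimpleModule k (k ⧸ m) := isSimpleModule_iff_quot_maximal.2 ⟨m, hm, ⟨.refl _ _⟩⟩
      let q : (k ⧸ m) →ₗ[k] I := m.liftQ (LinearMap.toSpanSingleton k I x) fun a ha => hmx a ha
      let ev : ((V ⧸ N) →ₗ[k] I) →ₗ[k] LinearMap.range q := LinearMap.codRestrict _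
        (LinearMap.applyₗ (e.symm (Submodule.Quotient.mk 1))) fun f => by
          obtain ⟨b, hb⟩ := hx (f (e.symm (Submodule.Quotient.mk 1))) fun a ha => by
            rw [← map_smul, ← map_smul, ← Submodule.Quotient.mk_smul, smul_eq_mul, mul_one,
              (Submodule.Quotient.mk_eq_zero m).2 ha, map_zero, map_zero]
          exact ⟨Submodule.Quotient.mk b, hb.symm⟩
      have hev : Function.Injective ev := by
        rw [← LinearMap.ker_eq_bot, LinearMap.ker_eq_bot']
        intro f hf
        have hf' : f (e.symm (Submodule.Quotient.mk 1)) = 0 := congrArg Subtype.val hf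
        ext v
        obtain ⟨a, ha⟩ := Submodule.Quotient.mk_surjective _ (e (Submodule.Quotient.mk v))
        have : (Submodule.Quotient.mk v : V ⧸ N) = a • e.symm (Submodule.Quotient.mk 1) := by
          rw [← map_smul, ← Submodule.Quotient.mk_smul, smul_eq_mul, mul_one, ha,
            e.symm_apply_apply]
        exact (congrArg f this).trans (by rw [map_smul, hf', smul_zero]; rfl)
      calc _ ≤ _ := Module.length_le_of_injective ev hev
        _ ≤ Module.length k (k ⧸ m) :=
          Module.length_le_of_surjective q.rangeRestrict q.surjective_rangeRestrict
        _ = 1 := Module.length_eq_one k _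
    let res : (V →ₗ[k] I) →ₗ[k] (N →ₗ[k] I) := LinearMap.lcomp k I N.subtype
    have h2 : Module.length k (V →ₗ[k] I) ≤
        Module.length k ((V ⧸ N) →ₗ[k] I) + Module.length k (N →ₗ[k] I) := by
      rw [Module.length_eq_add_of_exact (LinearMap.lcomp k I N.mkQ) res.rangeRestrict
        (fun f g h => LinearMap.cancel_right N.mkQ_surjective |>.1 h)
        res.surjective_rangeRestrict fun f => ⟨fun h => ?_, ?_⟩]
      · exact add_le_add le_rfl
          (Module.length_le_of_injective (LinearMap.range res).subtype Subtype.val_injective)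
      · have h' : res f = 0 := congrArg Subtype.val h
        have hN : N ≤ LinearMap.ker f := fun n hn => LinearMap.congr_fun h' ⟨n, hn⟩
        exact ⟨N.liftQ f hN, N.liftQ_mkQ f hN⟩
      · rintro ⟨g, rfl⟩
        refine Subtype.ext (LinearMap.ext fun n => ?_)
        exact (congrArg g ((Submodule.Quotient.mk_eq_zero N).2 n.2)).trans (map_zero g)
    calc _ ≤ _ := h2
      _ ≤ 1 + Module.length k N := add_le_add h1 ih
      _ = Module.length k V := by
        rw [Module.length_eq_add_of_exact N.subtype N.mkQ N.injective_subtype N.mkQ_surjective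
          (LinearMap.exact_subtype_mkQ N), Module.length_eq_one k (V ⧸ N), add_comm]

theorem IsDualizing.exists_apply_ne_zero (hI : IsDualizing k I) {V : Type*} [AddCommGroup V]
    [Module k V] {N : Submodule k V} {v : V} (hv : v ∉ N) :
    ∃ f : V →ₗ[k] I, (∀ n ∈ N, f n = 0) ∧ f v ≠ 0 := by
  let a : Ideal k := LinearMap.ker (LinearMap.toSpanSingleton k (V ⧸ N) (Submodule.Quotient.mk v))
  have ha : a ≠ ⊤ := by
    intro h
    have : (1 : k) ∈ a := h ▸ trivial
    rw [LinearMap.mem_ker, LinearMap.toSpanSingleton_apply, one_smul] at this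
    exact hv ((Submodule.Quotient.mk_eq_zero N).1 this)
  obtain ⟨m, hm, ham⟩ := Ideal.exists_le_maximal a ha
  obtain ⟨x, hx0, hmx, -⟩ := hI.exists_generator m hm
  obtain ⟨f, hf⟩ := hI.baer.extension_property (a.liftQ _ le_rfl)
    (LinearMap.ker_eq_bot.1 (Submodule.ker_liftQ_eq_bot _ _ _ le_rfl))
    (a.liftQ (LinearMap.toSpanSingleton k I x) fun b hb => hmx b (ham hb))
  refine ⟨f.comp N.mkQ, fun n hn => ?_, ?_⟩
  · rw [LinearMap.comp_apply, show N.mkQ n = 0 from (Submodule.Quotient.mk_eq_zero N).2 hn,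
      map_zero]
  · have := LinearMap.congr_fun hf (Submodule.Quotient.mk 1)
    simp only [LinearMap.comp_apply, Submodule.liftQ_apply, LinearMap.toSpanSingleton_apply,
      one_smul] at this
    rw [LinearMap.comp_apply, Submodule.mkQ_apply, this]
    exact fun h => hx0 ((one_smul k x).symm.trans h)

theorem IsDualizing.dual_dual_surjective (hI : IsDualizing k I) {V : Type*} [AddCommGroup V]
    [Module k V] (hV : IsFiniteLength k V) (F : (V →ₗ[k] I) →ₗ[k] I) :
    ∃ v : V, ∀ f : V →ₗ[k] I, F f = f v := by
  let ev : V →ₗ[k] (V →ₗ[k] I) →ₗ[k] I := LinearMap.applyₗ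
  have hinj : Function.Injective ev := by
    rw [← LinearMap.ker_eq_bot, LinearMap.ker_eq_bot']
    intro v hv
    by_contra h
    obtain ⟨f, -, hf⟩ := hI.exists_apply_ne_zero (N := ⊥) (v := v) (by simpa using h)
    exact hf (LinearMap.congr_fun hv f)
  have h1 := hI.length_dual_le hV
  have hV' := Module.length_ne_top_iff.2 hV
  have hD : IsFiniteLength k (V →ₗ[k] I) :=
    Module.length_ne_top_iff.1 (h1.trans_lt hV'.lt_top).ne
  have h2 := (hI.length_dual_le hD).trans h1
  have h3 := Module.length_eq_add_of_exact ev (LinearMap.range ev).mkQ hinj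
    (Submodule.mkQ_surjective _) (LinearMap.exact_map_mkQ_range ev)
  rw [h3] at h2
  have h4 : Module.length k (((V →ₗ[k] I) →ₗ[k] I) ⧸ LinearMap.range ev) = 0 := by
    refine le_antisymm ((ENat.add_le_add_iff_left hV').1 ?_) zero_le
    rwa [add_zero]
  rw [Module.length_eq_zero_iff, Submodule.Quotient.subsingleton_iff] at h4
  obtain ⟨v, hv⟩ := LinearMap.range_eq_top.1 h4 F
  exact ⟨v, fun f => by rw [← hv]; rfl⟩

end Duality

section AlmostSplit

theorem isFiniteLength_prod {Λ : Type*} [Ring Λ] {M N : Type*} [AddCommGroup M] [Module Λ M]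
    [AddCommGroup N] [Module Λ N] (hM : IsFiniteLength Λ M) (hN : IsFiniteLength Λ N) :
    IsFiniteLength Λ (M × N) := by
  rw [isFiniteLength_iff_isNoetherian_isArtinian] at *
  obtain ⟨_, _⟩ := hM
  obtain ⟨_, _⟩ := hN
  exact ⟨inferInstance, inferInstance⟩

theorem IndecMod.isUnit_or_isNilpotent {Λ : Type u} [Ring Λ] {M : Type v} [AddCommGroup M]
    [Module Λ M] [IsNoetherian Λ M] [IsArtinian Λ M] (hM : IndecMod Λ M) (f : Module.End Λ M) :
    IsUnit f ∨ IsNilpotent f := by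
  obtain ⟨n, hn⟩ := Filter.eventually_atTop.1 f.eventually_isCompl_ker_pow_range_pow
  have hc := hn (n + 1) (by omega)
  rcases hM.2 _ _ le_top le_top hc.sup_eq_top hc.inf_eq_bot with h | h
  · refine .inl ((Module.End.isUnit_iff f).2 ?_)
    have hinj : Function.Injective f := by
      rw [← LinearMap.ker_eq_bot, ← le_bot_iff, ← h, pow_succ]
      exact LinearMap.ker_le_ker_comp _ _
    exact ⟨hinj, IsArtinian.surjective_of_injective_endomorphism f hinj⟩
  · exact .inr ⟨n + 1, LinearMap.range_eq_bot.1 h⟩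

theorem IndecMod.not_isUnit_add {Λ : Type u} [Ring Λ] {M : Type v} [AddCommGroup M]
    [Module Λ M] [IsNoetherian Λ M] [IsArtinian Λ M] (hM : IndecMod Λ M) {f g : Module.End Λ M}
    (hf : ¬ IsUnit f) (hg : ¬ IsUnit g) : ¬ IsUnit (f + g) := by
  rintro ⟨w, hw⟩
  have h1 : ¬ IsUnit (↑w⁻¹ * f) := by rwa [Units.isUnit_units_mul]
  have h2 : ¬ IsUnit (↑w⁻¹ * g) := by rwa [Units.isUnit_units_mul]
  have h3 : ↑w⁻¹ * g = 1 - ↑w⁻¹ * f := by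
    rw [eq_sub_iff_add_eq, ← mul_add, add_comm g f, ← hw, Units.inv_mul]
  exact h2 (h3 ▸ ((hM.isUnit_or_isNilpotent _).resolve_left h1).isUnit_one_sub)

variable {k : Type u} [CommRing k] {I : Type u} [AddCommGroup I] [Module k I]
  {Λ : Type u} [Ring Λ] [Algebra k Λ]
  {M : Type v} [AddCommGroup M] [Module Λ M] [Module k M] [IsScalarTower k Λ M]

/-- A nonzero functional on the endomorphism ring of an indecomposable module which vanishes on
the radical. -/
theorem IsDualizing.exists_functional (hI : IsDualizing k I) [IsNoetherian Λ M] [IsArtinian Λ M]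
    (hM : IndecMod Λ M) : ∃ φ : (M →ₗ[Λ] M) →ₗ[k] I, φ LinearMap.id ≠ 0 ∧
      ∀ h : M →ₗ[Λ] M, ¬ Function.Bijective h → φ h = 0 := by
  have hnt : Nontrivial M := by
    by_contra h
    rw [not_nontrivial_iff_subsingleton] at h
    exact hM.1 (Subsingleton.elim _ _)
  let N : Submodule k (M →ₗ[Λ] M) :=
    { carrier := {h | ¬ IsUnit (show Module.End Λ M from h)}
      add_mem' := fun hf hg => hM.not_isUnit_add hf hg
      zero_mem' := not_isUnit_zero (M₀ := Module.End Λ M)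
      smul_mem' := fun c h hh hc => hh (by
        rw [Module.End.isUnit_iff] at hc ⊢
        have hinj : Function.Injective h := fun x y hxy => hc.1 (congrArg (c • ·) hxy)
        exact ⟨hinj, IsArtinian.surjective_of_injective_endomorphism h hinj⟩) }
  have h1 : (LinearMap.id : M →ₗ[Λ] M) ∉ N := fun h => h (isUnit_one (M := Module.End Λ M))
  obtain ⟨φ, hφ, hφ1⟩ := hI.exists_apply_ne_zero h1
  exact ⟨φ, hφ1, fun h hh => hφ h fun hu => hh ((Module.End.isUnit_iff _).1 hu)⟩

theorem IsDualizing.exists_generators (hI : IsDualizing k I) {V : Type*} [AddCommGroup V]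
    [Module k V] (hV : IsFiniteLength k V) : ∃ (n : ℕ) (ξ : Fin n → V →ₗ[k] I),
      (∀ ζ, ∃ c : Fin n → k, ∑ j, c j • ξ j = ζ) ∧ ∀ x, (∀ j, ξ j x = 0) → x = 0 := by
  have hD : IsFiniteLength k (V →ₗ[k] I) := Module.length_ne_top_iff.1
    ((hI.length_dual_le hV).trans_lt (Module.length_ne_top_iff.2 hV).lt_top).ne
  have := (isFiniteLength_iff_isNoetherian_isArtinian.1 hD).1
  obtain ⟨n, ξ, hξ⟩ := Submodule.fg_iff_exists_fin_generating_family.1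
    (IsNoetherian.noetherian (⊤ : Submodule k (V →ₗ[k] I)))
  have hξ' : ∀ ζ, ∃ c : Fin n → k, ∑ j, c j • ξ j = ζ := fun ζ =>
    (Submodule.mem_span_range_iff_exists_fun k).1 (hξ ▸ Submodule.mem_top)
  refine ⟨n, ξ, hξ', fun x hx => ?_⟩
  by_contra h
  obtain ⟨ζ, -, hζ⟩ := hI.exists_apply_ne_zero (N := ⊥) (v := x) (by simpa using h)
  obtain ⟨c, rfl⟩ := hξ' ζ
  exact hζ (by simp [LinearMap.sum_apply, hx])

theorem IsDualizing.exists_representation (hI : IsDualizing k I) (hM : IsFiniteLength k M)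
    {n : ℕ} {ξ : Fin n → M →ₗ[k] I} (hξ : ∀ x, (∀ j, ξ j x = 0) → x = 0)
    (φ : (M →ₗ[Λ] M) →ₗ[k] I) : ∃ m : Fin n → M, ∀ h, φ h = ∑ j, ξ j (h (m j)) := by
  let ev : (M →ₗ[Λ] M) →ₗ[k] (Fin n → M →ₗ[k] I) :=
    { toFun := fun h j => (ξ j).comp (h.restrictScalars k)
      map_add' := fun f g => by ext; simp
      map_smul' := fun c f => by ext; simp }
  have hev : Function.Injective ev := by
    rw [← LinearMap.ker_eq_bot, LinearMap.ker_eq_bot']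
    exact fun h hh => LinearMap.ext fun x => hξ _ fun j => LinearMap.congr_fun (congrFun hh j) x
  obtain ⟨Φ, hΦ⟩ := hI.baer.extension_property ev hev φ
  choose m hm using fun j =>
    hI.dual_dual_surjective hM (Φ.comp (LinearMap.single k (fun _ => M →ₗ[k] I) j))
  refine ⟨m, fun h => ?_⟩
  rw [← hΦ, LinearMap.comp_apply, ← Finset.univ_sum_single (ev h), map_sum]
  exact Finset.sum_congr rfl fun j _ => hm j (ev h j)

theorem sum_apply_sub_single_smul {W : Type*} [AddCommGroup W] [Module Λ W] [Module k W]
    [IsScalarTower k Λ W] {n : ℕ} (η : Fin n → W →ₗ[k] I) (w : W) (c : Fin n → k) (j : Fin n)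
    (a : Λ) : ∑ l, η l ((algebraMap k Λ (c l) - (Pi.single j a : Fin n → Λ) l) • w) =
      ∑ l, c l • η l w - η j (a • w) := by
  have h : ∑ l, η l ((Pi.single j a : Fin n → Λ) l • w) = η j (a • w) := by
    rw [Finset.sum_eq_single j (fun l _ hl => by rw [Pi.single_eq_of_ne hl, zero_smul, map_zero])
      (fun h => absurd (Finset.mem_univ j) h), Pi.single_eq_same]
  simp only [sub_smul, map_sub, Finset.sum_sub_distrib, algebraMap_smul, map_smul, h]

theorem IsDualizing.exists_linearMap (hI : IsDualizing k I) (hM : IsFiniteLength k M)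
    {n : ℕ} {ξ : Fin n → M →ₗ[k] I} (hspan : ∀ ζ, ∃ c : Fin n → k, ∑ j, c j • ξ j = ζ)
    (hξ : ∀ x, (∀ j, ξ j x = 0) → x = 0)
    {Z : Type*} [AddCommGroup Z] [Module Λ Z] [Module k Z] [IsScalarTower k Λ Z]
    (ζ : Fin n → Z →ₗ[k] I) (hζ : ∀ a : Fin n → Λ, (∀ x : M, ∑ j, ξ j (a j • x) = 0) →
      ∀ z : Z, ∑ j, ζ j (a j • z) = 0) :
    ∃ h : Z →ₗ[Λ] M, ∀ j z, ξ j (h z) = ζ j z := by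
  have hζk : ∀ c : Fin n → k, ∑ j, c j • ξ j = 0 → ∀ z, ∑ j, c j • ζ j z = 0 := by
    intro c hc z
    have := hζ (fun j => algebraMap k Λ (c j)) (fun x => by
      simpa [LinearMap.sum_apply] using LinearMap.congr_fun hc x) z
    simpa using this
  have key : ∀ z, ∃ x, ∀ j, ξ j x = ζ j z := by
    intro z
    let ψ : (Fin n → k) →ₗ[k] M →ₗ[k] I := Fintype.linearCombination k ξ
    let χ : (Fin n → k) →ₗ[k] I := Fintype.linearCombination k fun j => ζ j z
    have hψ : Function.Surjective ψ := hspan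
    have hχ : LinearMap.ker ψ ≤ LinearMap.ker χ := fun c hc => hζk c hc z
    obtain ⟨x, hx⟩ := hI.dual_dual_surjective hM (((LinearMap.ker ψ).liftQ χ hχ).comp
      (ψ.quotKerEquivOfSurjective hψ).symm.toLinearMap)
    refine ⟨x, fun j => ?_⟩
    have h1 : ψ (Pi.single j 1) = ξ j := by simp [ψ, Fintype.linearCombination_apply_single]
    have h2 : χ (Pi.single j 1) = ζ j z := by simp [χ, Fintype.linearCombination_apply_single]
    rw [← hx, ← h1, ← h2, LinearMap.comp_apply, LinearEquiv.coe_coe,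
      show ψ (Pi.single j 1) = ψ.quotKerEquivOfSurjective hψ (Submodule.Quotient.mk (Pi.single j 1))
        from rfl, LinearEquiv.symm_apply_apply, Submodule.liftQ_apply]
  choose h hh using key
  have huniq : ∀ x y, (∀ j, ξ j x = ξ j y) → x = y := fun x y hxy =>
    sub_eq_zero.1 (hξ _ fun j => by rw [map_sub, hxy, sub_self])
  have smul : ∀ (a : Λ) z, h (a • z) = a • h z := by
    intro a z
    refine huniq _ _ fun j => ?_
    obtain ⟨c, hc⟩ := hspan ((ξ j).comp (Algebra.lsmul k k M a))
    have hxj : ∀ x, ∑ l, c l • ξ l x = ξ j (a • x) := fun x => by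
      simpa [LinearMap.sum_apply] using LinearMap.congr_fun hc x
    have := hζ _ (fun x => by rw [sum_apply_sub_single_smul, hxj, sub_self]) z
    rw [sum_apply_sub_single_smul, sub_eq_zero] at this
    rw [hh, ← this, ← hxj]
    exact Finset.sum_congr rfl fun l _ => by rw [hh]
  exact ⟨{ toFun := h
           map_add' := fun y z => huniq _ _ fun j => by simp only [map_add, hh]
           map_smul' := smul }, fun j z => hh z j⟩

/-- The maps out of an indecomposable module `M` which are not split monomorphisms are detected by
the solvability of one system of linear equations. -/
theorem exists_system_of_not_isSplitMonoHom (k : Type u) [CommRing k] [IsArtinianRing k]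
    {Λ : Type u} [Ring Λ] [Algebra k Λ] [Module.Finite k Λ] {M : Type v} [AddCommGroup M]
    [Module Λ M] [IsNoetherian Λ M] [IsArtinian Λ M] (hM : IndecMod Λ M) :
    ∃ (n r : ℕ) (A : Fin r → Fin n → Λ) (m : Fin n → M),
      (¬ ∃ z : Fin r → M, ∀ j, m j = ∑ i, A i j • z i) ∧
      ∀ (Z : Type v) [AddCommGroup Z] [Module Λ Z] (f : M →ₗ[Λ] Z), ¬ IsSplitMonoHom Λ f →
        ∃ z : Fin r → Z, ∀ j, f (m j) = ∑ i, A i j • z i := by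
  obtain ⟨I, _, _, hI⟩ := exists_isDualizing k
  let _ : Module k M := Module.compHom M (algebraMap k Λ)
  have : IsScalarTower k Λ M := ⟨fun a b x => by
    rw [Algebra.smul_def, mul_smul]
    rfl⟩
  have : Module.Finite k M := Module.Finite.trans Λ M
  have hMk : IsFiniteLength k M :=
    isFiniteLength_iff_isNoetherian_isArtinian.2 ⟨inferInstance, inferInstance⟩
  obtain ⟨n, ξ, hspan, hξ⟩ := hI.exists_generators hMk
  obtain ⟨φ, hφ1, hφ⟩ := hI.exists_functional hM
  obtain ⟨m, hm⟩ := hI.exists_representation hMk hξ φ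
  let R : Submodule k (Fin n → Λ) :=
    { carrier := {a | ∀ x : M, ∑ j, ξ j (a j • x) = 0}
      add_mem' := fun {a b} ha hb x => by
        simp only [Pi.add_apply, add_smul, map_add, Finset.sum_add_distrib, ha x, hb x, add_zero]
      zero_mem' := fun x => by simp
      smul_mem' := fun c a ha x => by
        simp only [Pi.smul_apply, smul_assoc, map_smul, ← Finset.smul_sum, ha x, smul_zero] }
  obtain ⟨r, A, hA⟩ := Submodule.fg_iff_exists_fin_generating_family.1 (IsNoetherian.noetherian R)
  have hAR : ∀ i, A i ∈ R := fun i => hA ▸ Submodule.subset_span ⟨i, rfl⟩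
  refine ⟨n, r, A, m, ?_, ?_⟩
  · rintro ⟨z, hz⟩
    apply hφ1
    rw [hm]
    simp only [LinearMap.id_apply, hz, map_sum]
    rw [Finset.sum_comm]
    exact Finset.sum_eq_zero fun i _ => hAR i (z i)
  · intro Z _ _ f hf
    let _ : Module k Z := Module.compHom Z (algebraMap k Λ)
    have : IsScalarTower k Λ Z := ⟨fun a b x => by
      rw [Algebra.smul_def, mul_smul]
      rfl⟩
    let T : (Fin r → Z) →ₗ[k] (Fin n → Z) :=
      { toFun := fun z j => ∑ i, A i j • z i
        map_add' := fun y z => by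
          ext j
          simp [Finset.sum_add_distrib]
        map_smul' := fun c z => by
          ext j
          simp [Finset.smul_sum, smul_comm c] }
    by_contra hcon
    have hT : (fun j => f (m j)) ∉ LinearMap.range T := by
      rintro ⟨z, hz⟩
      exact hcon ⟨z, fun j => (congrFun hz j).symm⟩
    obtain ⟨F, hF, hFm⟩ := hI.exists_apply_ne_zero hT
    let ζ : Fin n → Z →ₗ[k] I := fun j => F.comp (LinearMap.single k (fun _ => Z) j)
    have hFζ : ∀ y, F y = ∑ j, ζ j (y j) := fun y => by
      conv_lhs => rw [← Finset.univ_sum_single y, map_sum]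
      rfl
    obtain ⟨h, hh⟩ := hI.exists_linearMap hMk hspan hξ ζ fun a ha z => by
      obtain ⟨c, rfl⟩ := (Submodule.mem_span_range_iff_exists_fun k).1 (hA ▸ (show a ∈ R from ha))
      rw [← hFζ fun j => (∑ i, c i • A i) j • z]
      refine hF _ ⟨fun i => c i • z, funext fun j => ?_⟩
      change ∑ i, A i j • c i • z = _
      simp only [Finset.sum_apply, Pi.smul_apply, Finset.sum_smul, smul_assoc, smul_comm (A _ j)]
    refine hFm ?_
    rw [hFζ]
    simp only [← hh]
    rw [← hφ (h.comp f) fun hb => hf ?_, hm]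
    · rfl
    · let e := LinearEquiv.ofBijective _ hb
      exact ⟨e.symm.toLinearMap.comp h, LinearMap.ext fun x => e.symm_apply_apply x⟩

/-- Existence of left almost split maps. -/
theorem exists_leftAlmostSplit (k : Type u) [CommRing k] [IsArtinianRing k]
    {Λ : Type u} [Ring Λ] [Algebra k Λ] [Module.Finite k Λ] {M : Type v} [AddCommGroup M]
    [Module Λ M] [IsNoetherian Λ M] [IsArtinian Λ M] (hM : IndecMod Λ M) :
    ∃ (E : ModuleCat.{v} Λ) (φ : M →ₗ[Λ] E), IsFiniteLength Λ E ∧ ¬ IsSplitMonoHom Λ φ ∧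
      ∀ (Z : Type v) [AddCommGroup Z] [Module Λ Z] (f : M →ₗ[Λ] Z), IsFiniteLength Λ Z →
        ¬ IsSplitMonoHom Λ f → ∃ h : E →ₗ[Λ] Z, f = h.comp φ := by
  obtain ⟨n, r, A, m, hm, hA⟩ := exists_system_of_not_isSplitMonoHom k hM
  have : IsArtinianRing Λ := IsArtinianRing.of_finite k Λ
  let K : Set (Submodule Λ (M × (Fin r → Λ))) := {N | ∃ (Z : ModuleCat.{v} Λ) (f : M →ₗ[Λ] Z)
    (z : Fin r → Z), IsFiniteLength Λ Z ∧ (∀ j, f (m j) = ∑ i, A i j • z i) ∧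
      LinearMap.ker (f.coprod (Fintype.linearCombination Λ z)) = N}
  have hK : K.Nonempty := ⟨_, ModuleCat.of Λ PUnit, 0, 0, .of_subsingleton,
    fun j => Subsingleton.elim _ _, rfl⟩
  obtain ⟨N, ⟨Z, f, z, hZ, hfz, rfl⟩, hmin⟩ := WellFounded.has_min wellFounded_lt K hK
  set p := f.coprod (Fintype.linearCombination Λ z) with hp
  refine ⟨ModuleCat.of Λ (LinearMap.range p), p.rangeRestrict.comp (LinearMap.inl Λ M _),
    ?_, ?_, ?_⟩
  · exact hZ.of_injective (LinearMap.range p).injective_subtype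
  · rintro ⟨g, hg⟩
    refine hm ⟨fun i => g (p.rangeRestrict (0, Pi.single i 1)), fun j => ?_⟩
    rw [← LinearMap.id_apply (R := Λ) (m j), ← hg]
    simp only [LinearMap.comp_apply, ← map_smul, ← map_sum]
    congr 1
    refine Subtype.ext ?_
    simp [hp, hfz, Fintype.linearCombination_apply_single]
  · intro Z' _ _ f' hZ' hf'
    obtain ⟨z', hz'⟩ := hA Z' f' hf'
    set p' := f'.coprod (Fintype.linearCombination Λ z') with hp'
    have hle : LinearMap.ker p ≤ LinearMap.ker p' := by
      have hker : LinearMap.ker ((f.prod f').coprod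
          (Fintype.linearCombination Λ fun i => (z i, z' i))) =
            LinearMap.ker p ⊓ LinearMap.ker p' := by
        ext ⟨x, a⟩
        simp [hp, hp', Fintype.linearCombination_apply, Prod.ext_iff, Prod.fst_sum, Prod.snd_sum]
      have hmem : LinearMap.ker p ⊓ LinearMap.ker p' ∈ K := ⟨ModuleCat.of Λ (Z × Z'), f.prod f',
        fun i => (z i, z' i), isFiniteLength_prod hZ hZ', fun j => by
          simp [hfz, hz', Prod.ext_iff, Prod.fst_sum, Prod.snd_sum], hker⟩
      by_contra hle
      exact hmin _ hmem (inf_lt_left.2 hle)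
    refine ⟨((LinearMap.ker p).liftQ p' hle).comp p.quotKerEquivRange.symm.toLinearMap,
      LinearMap.ext fun x => ?_⟩
    have h1 := p.quotKerEquivRange_symm_apply_image (x, 0) ⟨(x, 0), rfl⟩
    have h2 : p.rangeRestrict (LinearMap.inl Λ M _ x) = ⟨p (x, 0), (x, 0), rfl⟩ := rfl
    rw [LinearMap.comp_apply, LinearMap.comp_apply, LinearMap.comp_apply, h2, LinearEquiv.coe_coe,
      h1, Submodule.mkQ_apply, Submodule.liftQ_apply]
    simp [hp']

/-- Existence of minimal left almost split maps. -/
theorem exists_minimal_leftAlmostSplit (k : Type u) [CommRing k] [IsArtinianRing k]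
    {Λ : Type u} [Ring Λ] [Algebra k Λ] [Module.Finite k Λ] {M : Type v} [AddCommGroup M]
    [Module Λ M] [IsNoetherian Λ M] [IsArtinian Λ M] (hM : IndecMod Λ M) :
    ∃ (E : ModuleCat.{v} Λ) (φ : M →ₗ[Λ] E), IsFiniteLength Λ E ∧ ¬ IsSplitMonoHom Λ φ ∧
      (∀ (Z : Type v) [AddCommGroup Z] [Module Λ Z] (f : M →ₗ[Λ] Z), IsFiniteLength Λ Z →
        ¬ IsSplitMonoHom Λ f → ∃ h : E →ₗ[Λ] Z, f = h.comp φ) ∧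
      ∀ θ : E →ₗ[Λ] E, θ.comp φ = φ → Function.Bijective θ := by
  let P : ModuleCat.{v} Λ → Prop := fun E => ∃ φ : M →ₗ[Λ] E, IsFiniteLength Λ E ∧
    ¬ IsSplitMonoHom Λ φ ∧ ∀ (Z : Type v) [AddCommGroup Z] [Module Λ Z] (f : M →ₗ[Λ] Z),
      IsFiniteLength Λ Z → ¬ IsSplitMonoHom Λ f → ∃ h : E →ₗ[Λ] Z, f = h.comp φ
  obtain ⟨E, ⟨φ, hE, hφ, has⟩, hmin⟩ := WellFounded.has_min
    (InvImage.wf (fun E : ModuleCat.{v} Λ => Module.length Λ E) wellFounded_lt) {E | P E}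
    (exists_leftAlmostSplit k hM)
  obtain ⟨_, _⟩ := isFiniteLength_iff_isNoetherian_isArtinian.1 hE
  refine ⟨E, φ, hE, hφ, has, fun θ hθ => ?_⟩
  have hinj : Function.Injective θ := by
    by_contra hinj
    refine hmin (ModuleCat.of Λ (LinearMap.range θ)) ⟨θ.rangeRestrict.comp φ,
      hE.of_injective (LinearMap.range θ).injective_subtype, ?_, ?_⟩ ?_
    · rintro ⟨g, hg⟩
      exact hφ ⟨g.comp θ.rangeRestrict, hg⟩
    · intro Z _ _ f hZ hf
      obtain ⟨h, rfl⟩ := has Z f hZ hf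
      refine ⟨h.comp (LinearMap.range θ).subtype, ?_⟩
      conv_lhs => rw [← hθ]
      rfl
    · have h := subLen_range_lt hinj
      have h' : (subLen Λ (LinearMap.range θ) : ℕ∞) < subLen Λ (⊤ : Submodule Λ E) := by
        exact_mod_cast h
      rwa [coe_subLen, coe_subLen, Module.length_top] at h'
  exact ⟨hinj, IsArtinian.surjective_of_injective_endomorphism θ hinj⟩

/-- A map out of `M` which is not a split monomorphism factors through a family of irreducible maps
to indecomposable modules. -/
theorem exists_irreducible_factorization (k : Type u) [CommRing k] [IsArtinianRing k]
    {Λ : Type u} [Ring Λ] [Algebra k Λ] [Module.Finite k Λ] {M : Type v} [AddCommGroup M]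
    [Module Λ M] [IsNoetherian Λ M] [IsArtinian Λ M] (hM : IndecMod Λ M) {Z : Type v}
    [AddCommGroup Z] [Module Λ Z] (hZ : IsFiniteLength Λ Z) {f : M →ₗ[Λ] Z}
    (hf : ¬ IsSplitMonoHom Λ f) :
    ∃ (ι : Type v) (E : ι → ModuleCat.{v} Λ) (a : ∀ i, M →ₗ[Λ] E i) (b : ∀ i, E i →ₗ[Λ] Z),
      (∀ i, IsFiniteLength Λ (E i) ∧ IndecMod Λ (E i) ∧ IsIrreducibleHom Λ (a i)) ∧
      ∀ x, (∀ i, b i (a i x) = 0) → f x = 0 := by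
  obtain ⟨E, φ, hE, hφ, has, hmin⟩ := exists_minimal_leftAlmostSplit k hM
  obtain ⟨_, _⟩ := isFiniteLength_iff_isNoetherian_isArtinian.1 hE
  obtain ⟨h, rfl⟩ := has Z f hZ hf
  obtain ⟨l, hl, hs⟩ :=
    exists_list_isIdempotentElem_sum_eq (1 : Module.End Λ E) IsIdempotentElem.one
  refine ⟨{p : Module.End Λ E // p ∈ l}, fun p => ModuleCat.of Λ (LinearMap.range p.1),
    fun p => p.1.rangeRestrict.comp φ, fun p => h.comp (LinearMap.range p.1).subtype,
    fun ⟨p, hp⟩ => ⟨hE.of_injective (LinearMap.range p).injective_subtype,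
      indecMod_coe_iff.2 (hl p hp).2, ?_, ?_, ?_⟩, fun x hx => ?_⟩
  · rintro ⟨g, hg⟩
    exact hφ ⟨g.comp p.rangeRestrict, hg⟩
  · rintro ⟨g, hg⟩
    have hg' : ∀ y, p.rangeRestrict (φ (g y)) = y := fun y => LinearMap.congr_fun hg y
    have hc := LinearMap.isCompl_of_proj (f := g.rangeRestrict.comp (p.rangeRestrict.comp φ))
      (by rintro ⟨_, y, rfl⟩; exact Subtype.ext (congrArg g (hg' y)))
    rcases hM.2 _ _ le_top le_top hc.sup_eq_top hc.inf_eq_bot with h0 | h0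
    · refine (hl p hp).2.1 ((Submodule.eq_bot_iff _).2 fun y hy => ?_)
      have := hg' ⟨y, hy⟩
      rw [LinearMap.range_eq_bot.1 h0] at this
      simpa using (congrArg Subtype.val this).symm
    · refine hφ ⟨g.comp p.rangeRestrict, LinearMap.ext fun x => ?_⟩
      exact LinearMap.ker_eq_bot.1 h0 (Subtype.ext (congrArg g (hg' _)))
  · intro W _ _ hW a b hab
    by_cases ha : IsSplitMonoHom Λ a
    · exact .inl ha
    obtain ⟨a', rfl⟩ := has W a hW ha
    right
    have hpp : ∀ x, p (p x) = p x := fun x => LinearMap.congr_fun (hl p hp).1 x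
    have hab' : ∀ x, p (φ x) = b (a' (φ x)) := fun x =>
      congrArg Subtype.val (LinearMap.congr_fun hab x)
    let θ : E →ₗ[Λ] E := LinearMap.id - p + (LinearMap.range p).subtype.comp (b.comp a')
    have hθ : θ.comp φ = φ := LinearMap.ext fun x => by
      simp [θ, hab' x]
    have hb := hmin θ hθ
    have hpθ : ∀ x, p (θ x) = b (a' x) := fun x => by
      obtain ⟨y, hy⟩ := (b (a' x)).2
      simp [θ, hpp, ← hy]
    refine ⟨(a'.comp (LinearEquiv.ofBijective θ hb).symm.toLinearMap).comp
      (LinearMap.range p).subtype, LinearMap.ext fun ⟨y, hy⟩ => Subtype.ext ?_⟩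
    obtain ⟨z, rfl⟩ := hy
    have := hpθ ((LinearEquiv.ofBijective θ hb).symm (p z))
    rw [← LinearEquiv.ofBijective_apply θ (hf := hb), LinearEquiv.apply_symm_apply, hpp] at this
    exact this.symm
  · have : ∀ l' : List (Module.End Λ E), (∀ p ∈ l', h (p (φ x)) = 0) → h (l'.sum (φ x)) = 0 := by
      intro l' h
      induction l' with
      | nil => simp
      | cons a t ih => simp_all
    have h1 := this l fun p hp => hx ⟨p, hp⟩
    rwa [hs] at h1

end AlmostSplit

section Chains

variable {Λ : Type u} [Ring Λ]

theorem IsGRInclusion.indecMod {X Y : Type v} [AddCommGroup X] [Module Λ X] [AddCommGroup Y]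
    [Module Λ Y] {f : X →ₗ[Λ] Y} (h : IsGRInclusion Λ f) : IndecMod Λ X := by
  have := h.2.2.1
  rw [← Submodule.map_top] at this
  exact this.of_map h.1

theorem IsGRInclusion.mu_le {X Y : Type v} [AddCommGroup X] [Module Λ X] [AddCommGroup Y]
    [Module Λ Y] [IsNoetherian Λ X] [IsArtinian Λ X] [IsNoetherian Λ Y] [IsArtinian Λ Y]
    {f : X →ₗ[Λ] Y} (h : IsGRInclusion Λ f) {P : Submodule Λ Y} (hP : P ≠ ⊤) :
    mu Λ P ≤ muMod Λ X := by
  have h1 := h.2.1.mu_add_le hP.lt_top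
  have h2 := h.2.2.2.2
  rw [mu_range h.1] at h2
  linarith

theorem IsGRInclusion.range_ne_top {X Y : Type v} [AddCommGroup X] [Module Λ X] [AddCommGroup Y]
    [Module Λ Y] [IsNoetherian Λ Y] [IsArtinian Λ Y]
    {f : X →ₗ[Λ] Y} (h : IsGRInclusion Λ f) (f' : X →ₗ[Λ] Y) : LinearMap.range f' ≠ ⊤ := by
  intro h'
  have hlt : LinearMap.range f < ⊤ := lt_top_iff_ne_top.2 h.2.2.2.1
  have h1 := subLen_lt_subLen hlt
  have h2 : Module.length Λ Y ≤ Module.length Λ X :=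
    Module.length_le_of_surjective f' (LinearMap.range_eq_top.1 h')
  rw [(LinearEquiv.ofInjective f h.1).length_eq, ← coe_subLen,
    ← Module.length_top (R := Λ) (M := Y), ← coe_subLen] at h2
  exact h1.not_ge (by exact_mod_cast h2)

/-- A morphism into the target of a Gabriel-Roiter inclusion is again one as soon as it is
injective. -/
theorem IsGRInclusion.of_injective {X Y : Type v} [AddCommGroup X] [Module Λ X] [AddCommGroup Y]
    [Module Λ Y] [IsNoetherian Λ X] [IsArtinian Λ X] [IsNoetherian Λ Y] [IsArtinian Λ Y]
    {f : X →ₗ[Λ] Y} (h : IsGRInclusion Λ f) {f' : X →ₗ[Λ] Y} (hf' : Function.Injective f') :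
    IsGRInclusion Λ f' := by
  refine ⟨hf', h.2.1, ?_, h.range_ne_top f', ?_⟩
  · rw [← Submodule.map_top]
    exact IndecSub.map hf' h.indecMod
  · rw [h.2.2.2.2, mu_range hf', mu_range h.1]

/-- Factoring a non-injective map `g` through an irreducible map while keeping the composite with
`c` surjective and the composite with `c ∘ u` a Gabriel-Roiter inclusion. -/
theorem exists_irreducible_step (k : Type u) [CommRing k] [IsArtinianRing k] [Algebra k Λ]
    [Module.Finite k Λ] {X M Y C : Type v} [AddCommGroup X] [Module Λ X] [IsNoetherian Λ X]
    [IsArtinian Λ X] [AddCommGroup M] [Module Λ M] [AddCommGroup Y] [Module Λ Y]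
    [IsNoetherian Λ Y] [IsArtinian Λ Y] [AddCommGroup C] [Module Λ C] [IsNoetherian Λ C]
    [IsArtinian Λ C] (hC : IndecMod Λ C) {u : X →ₗ[Λ] M} (hu : ¬ IsSplitMonoHom Λ u)
    {c : M →ₗ[Λ] C} {g : C →ₗ[Λ] Y} (hGR : IsGRInclusion Λ ((g.comp c).comp u))
    (hg : ¬ Function.Injective g) :
    ∃ (E : ModuleCat.{v} Λ) (a : C →ₗ[Λ] E) (b : E →ₗ[Λ] Y),
      IsFiniteLength Λ E ∧ IndecMod Λ E ∧ IsIrreducibleHom Λ a ∧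
      Function.Surjective (b.comp (a.comp c)) ∧
      IsGRInclusion Λ ((b.comp (a.comp c)).comp u) := by
  have hY : IsFiniteLength Λ Y := isFiniteLength_iff_isNoetherian_isArtinian.2 ⟨‹_›, ‹_›⟩
  have hgs : ¬ IsSplitMonoHom Λ g := fun ⟨r, hr⟩ =>
    hg (Function.LeftInverse.injective fun x => LinearMap.congr_fun hr x)
  obtain ⟨ι, E, a, b, hE, hab⟩ := exists_irreducible_factorization k hC hY hgs
  have hX := hGR.indecMod
  obtain ⟨i, hi⟩ := hX.detectsInjective ι (fun _ => Y)
    (fun i => ((b i).comp ((a i).comp c)).comp u)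
    (fun x hx => hGR.1 (by simpa using hab (c (u x)) hx))
    (fun i => hGR.mu_le (hGR.range_ne_top _))
  refine ⟨E i, a i, b i, (hE i).1, (hE i).2.1, (hE i).2.2, ?_, hGR.of_injective hi⟩
  rw [← LinearMap.range_eq_top]
  by_contra hU
  set α := (b i).comp ((a i).comp c)
  obtain ⟨r, hr⟩ := hX.isSplitMonoHom_of_muMod_le (f := α.rangeRestrict.comp u)
    (fun x y hxy => hi (congrArg Subtype.val hxy)) (by rw [muMod_coe]; exact hGR.mu_le hU)
  exact hu ⟨r.comp α.rangeRestrict, hr⟩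

/-- A finite length indecomposable module factoring a map `M → Y` which is surjective and whose
composite with `u` is a Gabriel-Roiter inclusion. -/
structure GRFactorization {X M : Type v} [AddCommGroup X] [Module Λ X] [AddCommGroup M]
    [Module Λ M] (u : X →ₗ[Λ] M) (Y : Type v) [AddCommGroup Y] [Module Λ Y] where
  obj : ModuleCat.{v} Λ
  ι : M →ₗ[Λ] obj
  π : obj →ₗ[Λ] Y
  isFiniteLength : IsFiniteLength Λ obj
  indecMod : IndecMod Λ obj
  surjective : Function.Surjective (π.comp ι)
  isGRInclusion : IsGRInclusion Λ ((π.comp ι).comp u)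

theorem GRFactorization.exists_irreducible (k : Type u) [CommRing k] [IsArtinianRing k]
    [Algebra k Λ] [Module.Finite k Λ] {X M Y : Type v} [AddCommGroup X] [Module Λ X]
    [IsNoetherian Λ X] [IsArtinian Λ X] [AddCommGroup M] [Module Λ M] [AddCommGroup Y]
    [Module Λ Y] [IsNoetherian Λ Y] [IsArtinian Λ Y] {u : X →ₗ[Λ] M}
    (hu : ¬ IsSplitMonoHom Λ u) (s : GRFactorization u Y) :
    ∃ (t : GRFactorization u Y) (a : s.obj →ₗ[Λ] t.obj), t.ι = a.comp s.ι ∧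
      (¬ Function.Injective s.π → IsIrreducibleHom Λ a) := by
  by_cases hs : Function.Injective s.π
  · exact ⟨s, LinearMap.id, rfl, fun h => absurd hs h⟩
  obtain ⟨_, _⟩ := isFiniteLength_iff_isNoetherian_isArtinian.1 s.isFiniteLength
  obtain ⟨E, a, b, h1, h2, h3, h4, h5⟩ :=
    exists_irreducible_step k s.indecMod hu s.isGRInclusion hs
  exact ⟨⟨E, a.comp s.ι, b, h1, h2, h4, h5⟩, a, rfl, fun _ => h3⟩

end Chains

/-- Assume `u : X → M` is an irreducible monomorphism with `M`
indecomposable and `g₀ : M → Y` is an epimorphism such that `g₀ ∘ u` is a Gabriel-Roiter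
inclusion. Then either (a) there is a chain of irreducible maps
`M = M_0 → M_1 → ⋯ → M_n = Y` through indecomposable modules whose composite is an
epimorphism and such that composite ∘ u is a Gabriel-Roiter inclusion, or (b) for every
`m` there is such a chain `M = M_0 → M_1 → ⋯ → M_m` together with a further map
`g : M_m → Y` with `g ∘ f_m ∘ ⋯ ∘ f_1` an epimorphism and `g ∘ f_m ∘ ⋯ ∘ f_1 ∘ u` a
Gabriel-Roiter inclusion. (The chain is recorded by the objects `C i`, the irreducible
maps `fs i`, and the partial composites `cmp i`; the identifications of the endpoints
with `M` resp. `Y` are given by linear equivalences.) -/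
theorem gabriel_roiter_stmt2
    (k : Type u) [CommRing k] [IsArtinianRing k]
    (Λ : Type u) [Ring Λ] [Algebra k Λ] [Module.Finite k Λ]
    (X : Type v) [AddCommGroup X] [Module Λ X] (hXfl : IsFiniteLength Λ X)
    (M : Type v) [AddCommGroup M] [Module Λ M] (hMfl : IsFiniteLength Λ M)
    (Y : Type v) [AddCommGroup Y] [Module Λ Y] (hYfl : IsFiniteLength Λ Y)
    (hMind : IndecMod Λ M)
    (u : X →ₗ[Λ] M) (hu : IsIrreducibleHom Λ u) (humono : Function.Injective u)
    (g₀ : M →ₗ[Λ] Y) (hg₀ : Function.Surjective g₀)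
    (hGR : IsGRInclusion Λ (g₀.comp u)) :
    (∃ (n : ℕ) (C : Fin (n + 1) → ModuleCat.{v} Λ)
        (e0 : (↥(C 0)) ≃ₗ[Λ] M) (en : (↥(C (Fin.last n))) ≃ₗ[Λ] Y)
        (fs : ∀ i : Fin n, (↥(C i.castSucc)) →ₗ[Λ] ↥(C i.succ))
        (cmp : ∀ i : Fin (n + 1), (↥(C 0)) →ₗ[Λ] ↥(C i)),
        (∀ i, IsFiniteLength Λ (C i) ∧ IndecMod Λ (C i)) ∧
        (∀ i : Fin n, IsIrreducibleHom Λ (fs i)) ∧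
        cmp 0 = LinearMap.id ∧
        (∀ i : Fin n, cmp i.succ = (fs i).comp (cmp i.castSucc)) ∧
        Function.Surjective
          (en.toLinearMap.comp ((cmp (Fin.last n)).comp e0.symm.toLinearMap)) ∧
        IsGRInclusion Λ
          ((en.toLinearMap.comp ((cmp (Fin.last n)).comp e0.symm.toLinearMap)).comp u))
    ∨
    (∀ m : ℕ, ∃ (C : Fin (m + 1) → ModuleCat.{v} Λ)
        (e0 : (↥(C 0)) ≃ₗ[Λ] M)
        (fs : ∀ i : Fin m, (↥(C i.castSucc)) →ₗ[Λ] ↥(C i.succ))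
        (cmp : ∀ i : Fin (m + 1), (↥(C 0)) →ₗ[Λ] ↥(C i))
        (g : (↥(C (Fin.last m))) →ₗ[Λ] Y),
        (∀ i, IsFiniteLength Λ (C i) ∧ IndecMod Λ (C i)) ∧
        (∀ i : Fin m, IsIrreducibleHom Λ (fs i)) ∧
        cmp 0 = LinearMap.id ∧
        (∀ i : Fin m, cmp i.succ = (fs i).comp (cmp i.castSucc)) ∧
        Function.Surjective
          ((g.comp (cmp (Fin.last m))).comp e0.symm.toLinearMap) ∧
        IsGRInclusion Λ
          (((g.comp (cmp (Fin.last m))).comp e0.symm.toLinearMap).comp u)) := by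
  classical
  obtain ⟨_, _⟩ := isFiniteLength_iff_isNoetherian_isArtinian.1 hXfl
  obtain ⟨_, _⟩ := isFiniteLength_iff_isNoetherian_isArtinian.1 hYfl
  choose next a ha hirr using
    fun s : GRFactorization u Y => s.exists_irreducible k hu.1
  let s : ℕ → GRFactorization u Y := fun n => Nat.rec
    ⟨ModuleCat.of Λ M, LinearMap.id, g₀, hMfl, hMind, hg₀, hGR⟩ (fun _ => next) n
  by_cases h : ∃ n, Function.Injective (s n).π
  · left
    let n := Nat.find h
    have hn : Function.Bijective (s n).π :=
      ⟨Nat.find_spec h, Function.Surjective.of_comp (g := (s n).ι) (s n).surjective⟩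
    exact ⟨n, fun i => (s i).obj, LinearEquiv.refl Λ M, LinearEquiv.ofBijective _ hn,
      fun i => a (s i), fun i => (s i).ι, fun i => ⟨(s i).isFiniteLength, (s i).indecMod⟩,
      fun i => hirr _ (Nat.find_min h i.2), rfl, fun i => ha _, (s n).surjective,
      (s n).isGRInclusion⟩
  · right
    push Not at h
    exact fun m => ⟨fun i => (s i).obj, LinearEquiv.refl Λ M, fun i => a (s i), fun i => (s i).ι,
      (s m).π, fun i => ⟨(s i).isFiniteLength, (s i).indecMod⟩, fun i => hirr _ (h i), rfl,
      fun i => ha _, (s m).surjective, (s m).isGRInclusion⟩
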